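/- arXiv:1707.06536 — 4 statements merged into one kernel-verified Lean document; each statement's English description precedes it below -/
import Mathlib

section
/- Let (R, 𝔪) be a Noetherian local ring, 𝔞 an ideal, and M a relative Cohen-Macaulay R-module with respect to 𝔞 with cd(𝔞, M) = c. Then Ann_R(H^c_𝔞(M)) = Ann_R(M/T_R(𝔞, M)) = Ann_R(M). -/
open CategoryTheory

/-- `HasCD a M c` : the cohomological dimension of `M` with respect to `a` is `c`,
i.e. `H^c_a(M) ≠ 0` and `H^i_a(M) = 0` for all `i > c`. -/
def HasCD {R : Type} [CommRing R] (a : Ideal R) (M : ModuleCat R) (c : ℕ) : Prop :=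
  Nontrivial ((localCohomology a c).obj M) ∧
    ∀ i, c < i → Subsingleton ((localCohomology a i).obj M)

/-- The attached primes of an `R`-module `A`: primes of the form `Ann_R(A/B)`. -/
def attachedPrimes (R : Type) [CommRing R] (A : Type) [AddCommGroup A] [Module R A] :
    Set (Ideal R) :=
  {p | p.IsPrime ∧ ∃ B : Submodule R A, p = Module.annihilator R (A ⧸ B)}


section
open CategoryTheory Limits Opposite

namespace RCM
variable {R : Type} [CommRing R]

/-- map of Hom complexes -/
noncomputable def yMap {P P' : ChainComplex (ModuleCat.{0} R) ℕ} (φ : P' ⟶ P) (Y : ModuleCat.{0} R) :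
    P.linearYonedaObj R Y ⟶ P'.linearYonedaObj R Y :=
  (HomologicalComplex.unopFunctor _ _).map
    ((((linearYoneda R (ModuleCat.{0} R)).obj Y).rightOp.mapHomologicalComplex _).map φ).op

lemma yMap_f {P P' : ChainComplex (ModuleCat.{0} R) ℕ} (φ : P' ⟶ P) (Y : ModuleCat.{0} R) (n : ℕ)
   (f : P.X n ⟶ Y) : (yMap φ Y).f n f = (φ.f n ≫ f : P'.X n ⟶ Y) := rfl

lemma abs_aux {C : Type*} [Category C] {a a' b b' : C} {c c' : C} (A : a ⟶ a') (u' : op b' ≅ op a')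
    (u : op b ≅ op a)
    (v : op b ≅ op c) (v' : op b' ≅ op c') (B : op b' ⟶ op b) (D : c ⟶ c')
    (h2 : u'.hom ≫ A.op = B ≫ u.hom) (h3 : B ≫ v.hom = v'.hom ≫ D.op) :
    A ≫ (u'.unop ≪≫ v'.unop.symm).hom = (u.unop ≪≫ v.unop.symm).hom ≫ D := by
  apply Quiver.Hom.op_inj
  have : u'.hom ≫ A.op ≫ u.inv = B := by simp [reassoc_of% h2]
  have h4 : v'.inv ≫ B = D.op ≫ v.inv := by
    rw [Iso.inv_comp_eq, ← Category.assoc, Iso.eq_comp_inv, h3]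
  simp [h2, reassoc_of% h4]

lemma isoExt_nat {X X' : ModuleCat.{0} R} (g : X' ⟶ X) (P : ProjectiveResolution X)
    (P' : ProjectiveResolution X') (φ : P'.complex ⟶ P.complex) 
    (hφ : φ.f 0 ≫ P.π.f 0 = P'.π.f 0 ≫ g) (n : ℕ) (Y : ModuleCat.{0} R) :
    ((Ext R (ModuleCat.{0} R) n).map g.op).app Y ≫ (P'.isoExt n Y).hom =
     (P.isoExt n Y).hom ≫ HomologicalComplex.homologyMap (yMap φ Y) n := by
  let F := ((linearYoneda R (ModuleCat.{0} R)).obj Y).rightOp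
  have h := ProjectiveResolution.isoLeftDerivedObj_inv_naturality g P' P φ hφ F n
  have h3 := HomologicalComplex.homologyOp_hom_naturality (yMap φ Y) n
  exact abs_aux (((Ext R (ModuleCat.{0} R) n).map g.op).app Y) (P'.isoLeftDerivedObj F n).symm
    (P.isoLeftDerivedObj F n).symm (HomologicalComplex.homologyOp (P.complex.linearYonedaObj R Y) n)
    (HomologicalComplex.homologyOp (P'.complex.linearYonedaObj R Y) n) _ _ h h3

/-- class of a cocycle in homology. -/
lemma exists_cocycle (K : CochainComplex (ModuleCat.{0} R) ℕ) (n : ℕ) (z : K.homology n) :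
    ∃ c : K.cycles n, K.homologyπ n c = z := 
  (ModuleCat.epi_iff_surjective _).1 inferInstance z

lemma homologyπ_eq_zero_iff (K : CochainComplex (ModuleCat.{0} R) ℕ) (n : ℕ) (c : K.cycles n) :
    K.homologyπ n c = 0 ↔ ∃ b, K.d ((ComplexShape.up ℕ).prev n) n b = K.iCycles n c := by
  have hex := ShortComplex.exact_of_g_is_cokernel
    (.mk _ _ (K.toCycles_comp_homologyπ _ n)) (K.homologyIsCokernel _ n rfl)
  rw [ShortComplex.moduleCat_exact_iff] at hex
  constructor
  · intro h
    obtain ⟨b, hb⟩ := hex c h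
    refine ⟨b, ?_⟩
    rw [← hb, ← K.toCycles_i]
    rfl
  · rintro ⟨b, hb⟩
    have hinj := (ModuleCat.mono_iff_injective (K.iCycles n)).1 inferInstance
    have : K.toCycles _ n b = c := by
      apply hinj
      rw [← hb, ← K.toCycles_i]
      rfl
    rw [← this]
    have := K.toCycles_comp_homologyπ ((ComplexShape.up ℕ).prev n) n
    exact congrArg (fun f => f.hom b) this

noncomputable abbrev oldExt (X Y : ModuleCat.{0} R) (n : ℕ) : ModuleCat.{0} R :=
  ((Ext R (ModuleCat.{0} R) n).obj (op X)).obj Y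

def Rel {X Y : ModuleCat.{0} R} (P : ProjectiveResolution X) {n : ℕ} (ξ : oldExt X Y n)
    (f : P.complex.X n ⟶ Y) : Prop :=
  ∃ c : (P.complex.linearYonedaObj R Y).cycles n,
    (P.complex.linearYonedaObj R Y).homologyπ n c = (P.isoExt (R := R) n Y).hom ξ ∧
    (P.complex.linearYonedaObj R Y).iCycles n c = f

section
variable {X Y : ModuleCat.{0} R} (P : ProjectiveResolution X) {n : ℕ} 

lemma Rel.cocycle {ξ : oldExt X Y n} {f : P.complex.X n ⟶ Y} (h : Rel P ξ f) :
    P.complex.d (n+1) n ≫ f = 0 := by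
  obtain ⟨c, h1, rfl⟩ := h
  have := (P.complex.linearYonedaObj R Y).iCycles_d n (n+1)
  exact congrArg (fun f => f.hom c) this

lemma Rel.exists_f (ξ : oldExt X Y n) : ∃ f, Rel P ξ f := by
  obtain ⟨c, hc⟩ := exists_cocycle _ _ ((P.isoExt (R := R) n Y).hom ξ)
  exact ⟨_, c, hc, rfl⟩

lemma Rel.exists_ξ (f : P.complex.X n ⟶ Y) (hf : P.complex.d (n+1) n ≫ f = 0) :
    ∃ ξ : oldExt X Y n, Rel P ξ f := by
  have hex := ShortComplex.exact_of_f_is_kernel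
    (.mk _ _ ((P.complex.linearYonedaObj R Y).iCycles_d n (n+1)))
    ((P.complex.linearYonedaObj R Y).cyclesIsKernel n (n+1) (by simp))
  rw [ShortComplex.moduleCat_exact_iff] at hex
  obtain ⟨c, hc⟩ := hex f hf
  refine ⟨(P.isoExt (R := R) n Y).inv ((P.complex.linearYonedaObj R Y).homologyπ n c), c, ?_, hc⟩
  simp

lemma Rel.smul {ξ : oldExt X Y n} {f : P.complex.X n ⟶ Y} (h : Rel P ξ f) (r : R) :
    Rel P (r • ξ) (r • f) := by
  obtain ⟨c, h1, rfl⟩ := h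
  exact ⟨r • c, by simp [h1], map_smul _ _ _⟩

lemma Rel.map {X' : ModuleCat.{0} R} (g : X' ⟶ X) 
    (P' : ProjectiveResolution X') (φ : P'.complex ⟶ P.complex) 
    (hφ : φ.f 0 ≫ P.π.f 0 = P'.π.f 0 ≫ g)
    {ξ : oldExt X Y n} {f : P.complex.X n ⟶ Y} (h : Rel P ξ f) :
    Rel P' (((Ext R (ModuleCat.{0} R) n).map g.op).app Y ξ) (φ.f n ≫ f) := by
  obtain ⟨c, h1, rfl⟩ := h
  refine ⟨HomologicalComplex.cyclesMap (yMap φ Y) n c, ?_, ?_⟩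
  · have e1 := congrArg (fun f => f.hom ξ) (isoExt_nat g P P' φ hφ n Y)
    have e2 := congrArg (fun f => f.hom c) (HomologicalComplex.homologyπ_naturality (yMap φ Y) n)
    dsimp at e1 e2
    rw [e1, ← h1, e2]
  · have e2 := congrArg (fun f => f.hom c) (HomologicalComplex.cyclesMap_i (yMap φ Y) n)
    exact e2

lemma extMk_zero_iff (f : P.complex.X 0 ⟶ Y) (hf : P.complex.d 1 0 ≫ f = 0) :
    P.extMk f 1 rfl hf = 0 ↔ f = 0 := by
  constructor
  · intro h
    simp only [← P.extEquivCohomologyClass.apply_eq_iff_eq,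
      ProjectiveResolution.extEquivCohomologyClass_extMk, ProjectiveResolution.extEquivCohomologyClass_zero,
      CochainComplex.HomComplex.CohomologyClass.mk_eq_zero_iff] at h
    rw [CochainComplex.HomComplex.Cocycle.toSingleMk_mem_coboundaries_iff _ _ _ _ _ (1) (by simp)] at h
    obtain ⟨g, hg⟩ := h
    have : g = 0 := by
      apply IsZero.eq_of_src
      exact CochainComplex.isZero_of_isStrictlyLE _ 0 _ (by simp)
    rw [this] at hg
    rw [← cancel_epi (P.cochainComplexXIso (-(0:ℕ)) 0 rfl).hom]
    simpa using hg.symm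
  · rintro rfl; simp

lemma Rel.zero_iff {ξ : oldExt X Y n} {f : P.complex.X n ⟶ Y} (h : Rel P ξ f) :
    ξ = 0 ↔ P.extMk f (n+1) rfl (h.cocycle P) = 0 := by
  have hinj : ξ = 0 ↔ (P.isoExt (R := R) n Y).hom ξ = 0 := by
    constructor
    · rintro rfl; simp
    · intro h
      apply ((ModuleCat.mono_iff_injective (P.isoExt (R := R) n Y).hom).1 inferInstance)
      simpa using h
  have hc := h.cocycle P
  change _ ↔ P.extMk f (n+1) rfl hc = 0
  obtain ⟨c, h1, h2⟩ := h
  have key := homologyπ_eq_zero_iff (P.complex.linearYonedaObj R Y) n c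
  rw [h1, h2] at key
  refine (hinj.trans key).trans ?_
  cases n with
  | zero =>
    rw [extMk_zero_iff]
    constructor
    · rintro ⟨b, hb⟩
      rw [← hb, (P.complex.linearYonedaObj R Y).shape _ _ (by simp)]
      rfl
    · intro hb
      refine ⟨0, ?_⟩
      rw [hb, map_zero]
      rfl
  | succ n =>
    rw [P.extMk_eq_zero_iff _ _ _ _ n rfl]
    have : (ComplexShape.up ℕ).prev (n+1) = n := by simp
    rw [this]
    rfl
end
end RCM

end

section
open CategoryTheory Limits Opposite

namespace RCM
variable {R : Type} [CommRing R]

lemma extMk_smul {X Y : ModuleCat.{0} R} (P : ProjectiveResolution X) {n : ℕ}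
    (f : P.complex.X n ⟶ Y) (hf : P.complex.d (n+1) n ≫ f = 0) (x : R)
    (hf' : P.complex.d (n+1) n ≫ (x • f) = 0) :
    P.extMk (x • f) (n+1) rfl hf' = x • P.extMk f (n+1) rfl hf := by
  rw [Abelian.Ext.smul_eq_comp_mk₀, P.extMk_comp_mk₀]
  congr 1

lemma lift_comm {X X' : ModuleCat.{0} R} (P : ProjectiveResolution X)
    (P' : ProjectiveResolution X') (g : X' ⟶ X) :
    (ProjectiveResolution.lift g P' P).f 0 ≫ P.π.f 0 = P'.π.f 0 ≫ g := by
  have := congrArg (fun f => HomologicalComplex.Hom.f f 0) (ProjectiveResolution.lift_commutes g P' P)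
  rw [HomologicalComplex.comp_f] at this
  refine this.trans ?_
  rw [HomologicalComplex.comp_f]
  congr 1

lemma compat {X X' Y : ModuleCat.{0} R} (P : ProjectiveResolution X) (g : X' ⟶ X) {n : ℕ}
    (ξ : oldExt X Y n) (f : P.complex.X n ⟶ Y) (h : Rel P ξ f) (x : R) :
    x • (((Ext R (ModuleCat.{0} R) n).map g.op).app Y ξ) = 0 ↔
      (Abelian.Ext.mk₀ g).comp (x • P.extMk f (n+1) rfl (h.cocycle P)) (zero_add n) = 0 := by
  let P' := projectiveResolution X'
  let φ : ProjectiveResolution.Hom P' P g :=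
    ⟨ProjectiveResolution.lift g P' P, lift_comm P P' g⟩
  have h' := (h.smul P x).map P g P' φ.hom φ.hom_f_zero_comp_π_f_zero
  have e := map_smul (((Ext R (ModuleCat.{0} R) n).map g.op).app Y).hom x ξ
  refine Iff.trans (by rw [← e]) (Iff.trans (h'.zero_iff P') ?_)
  rw [ ← extMk_smul P f (h.cocycle P) x ((h.smul P x).cocycle P), P.mk₀_comp_extMk _ _ _ _ φ]

variable (a : Ideal R)

abbrev Q (t : ℕ) : ModuleCat.{0} R := ModuleCat.of R (R ⧸ a ^ t)

abbrev π {s t : ℕ} (h : t ≤ s) : Q a s ⟶ Q a t :=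
  ModuleCat.ofHom (Submodule.mapQ _ _ LinearMap.id (Ideal.pow_le_pow_right h))

def PP (x : R) (i : ℕ) (M : ModuleCat.{0} R) : Prop :=
  ∀ (t : ℕ) (η : Abelian.Ext (Q a t) M i), ∃ s, ∃ h : t ≤ s,
    (Abelian.Ext.mk₀ (π a h)).comp (x • η) (zero_add i) = 0

lemma mem_ann_iff (x : R) (i : ℕ) (M : ModuleCat.{0} R) :
    x ∈ Module.annihilator R ((localCohomology a i).obj M) ↔ PP a x i M := by
  let F := localCohomology.diagram (localCohomology.idealPowersDiagram a) i
  let G := F ⋙ (evaluation _ _).obj M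
  let co : Cocone G := ((evaluation _ _).obj M).mapCocone (colimit.cocone F)
  let hco : IsColimit co := isColimitOfPreserves ((evaluation _ _).obj M) (colimit.isColimit F)
  have hpt : ((localCohomology a i).obj M) = co.pt := rfl
  have hobj (j) : G.obj j = oldExt (Q a j.unop.unop) M i := rfl
  rw [hpt, Module.mem_annihilator]
  constructor
  · intro H t η
    let P := projectiveResolution (Q a t)
    obtain ⟨f, hf, rfl⟩ := P.extMk_surjective η (i+1) rfl
    obtain ⟨ξ, hξ⟩ := Rel.exists_ξ P f hf
    have h0 : co.ι.app (op (op t)) (x • ξ : oldExt (Q a t) M i) = 0 := 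
      (map_smul (co.ι.app (op (op t))).hom x (ξ : G.obj (op (op t)))).trans (H _)
    have h1 := h0.trans (map_zero (co.ι.app (op (op t))).hom).symm
    obtain ⟨k, u, v, huv⟩ := (Concrete.isColimit_rep_eq_iff_exists G hco _ _).1 h1
    refine ⟨k.unop.unop, u.unop.unop.down.down, ?_⟩
    rw [← compat P _ ξ f hξ x, ← map_smul]
    rw [map_zero] at huv
    exact huv
  · intro H z
    obtain ⟨j, ξ, rfl⟩ := Concrete.isColimit_exists_rep G hco z
    obtain ⟨t, rfl⟩ : ∃ t : ℕ, j = op (op t) := ⟨j.unop.unop, rfl⟩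
    change oldExt (Q a t) M i at ξ
    let P := projectiveResolution (Q a t)
    obtain ⟨f, hf⟩ := Rel.exists_f P ξ
    obtain ⟨s, h, hs⟩ := H t (P.extMk f (i+1) rfl (hf.cocycle P))
    rw [← compat P _ ξ f hf x, ← map_smul] at hs
    have hw := co.w (j := op (op s)) (j' := op (op t)) (homOfLE h).op.op
    have hw' := congrArg (fun f => f.hom (x • ξ : oldExt (Q a t) M i)) hw
    have : co.ι.app (op (op t)) (x • ξ : oldExt (Q a t) M i) = 0 := by
      refine Eq.trans hw'.symm ?_
      refine Eq.trans ?_ (map_zero (co.ι.app (op (op s))).hom)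
      exact congrArg (co.ι.app (op (op s))).hom hs
    exact (map_smul (co.ι.app (op (op t))).hom x (ξ : G.obj (op (op t)))).symm.trans this

lemma subsingleton_iff (i : ℕ) (M : ModuleCat.{0} R) :
    Subsingleton ((localCohomology a i).obj M) ↔ PP a 1 i M := by
  rw [← mem_ann_iff, ← Ideal.eq_top_iff_one, Module.annihilator_eq_top_iff]
end RCM

end

section
open CategoryTheory Limits Opposite

namespace RCM
variable {R : Type} [CommRing R] (a : Ideal R)
open Abelian

/-- all Ext vanish -/
def ExtZ (E : ModuleCat.{0} R) : Prop := ∀ (t i : ℕ) (e : Ext (Q a t) E i), e = 0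

lemma H1 {S : ShortComplex (ModuleCat.{0} R)} (hS : S.ShortExact) (hE : ExtZ a S.X₂) {x : R} {i : ℕ}
    (h : PP a x (i+1) S.X₁) : PP a x i S.X₃ := by
  intro t η
  obtain ⟨s, hs, e⟩ := h t (η.comp hS.extClass rfl)
  refine ⟨s, hs, ?_⟩
  have e2 : ((Ext.mk₀ (π a hs)).comp (x • η) (zero_add i)).comp hS.extClass rfl = 0 := by
    rw [Ext.comp_assoc _ _ _ _ rfl (by omega), Ext.smul_comp]
    exact e
  obtain ⟨z, hz⟩ := Ext.covariant_sequence_exact₃ _ hS _ rfl e2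
  rw [← hz, hE _ _ z, Ext.zero_comp]

lemma H2 {S : ShortComplex (ModuleCat.{0} R)} (hS : S.ShortExact) {i : ℕ}
    (h2 : PP a 1 i S.X₂) (h : PP a 1 (i+1) S.X₁) : PP a 1 i S.X₃ := by
  intro t η
  obtain ⟨s, hs, e⟩ := h t (η.comp hS.extClass rfl)
  have e2 : ((Ext.mk₀ (π a hs)).comp η (zero_add i)).comp hS.extClass rfl = 0 := by
    rw [Ext.comp_assoc _ _ _ _ rfl (by omega)]
    simpa using e
  obtain ⟨z, hz⟩ := Ext.covariant_sequence_exact₃ _ hS _ rfl e2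
  obtain ⟨s', hs', e'⟩ := h2 s z
  refine ⟨s', hs.trans hs', ?_⟩
  have : π a (hs.trans hs') = π a hs' ≫ π a hs := by
    ext; rfl
  rw [this, ← Ext.mk₀_comp_mk₀_assoc, one_smul, ← hz]
  rw [one_smul] at e'
  rw [← Ext.comp_assoc_of_third_deg_zero, e', Ext.zero_comp]

lemma H1' {S : ShortComplex (ModuleCat.{0} R)} (hS : S.ShortExact) {i : ℕ}
    (h2 : ∀ t, ∀ e : Ext (Q a t) S.X₂ (i+1), e = 0) (h : PP a 1 i S.X₃) : PP a 1 (i+1) S.X₁ := by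
  intro t η
  obtain ⟨z, hz⟩ := Ext.covariant_sequence_exact₁ _ hS η (h2 t _) rfl
  obtain ⟨s, hs, e⟩ := h t z
  refine ⟨s, hs, ?_⟩
  rw [one_smul] at e ⊢
  rw [← hz, ← Ext.comp_assoc _ _ _ (zero_add i) _ (by omega), e, Ext.zero_comp]

lemma H5 {E B : ModuleCat.{0} R} (hE : ExtZ a E) (f : B ⟶ E) [Mono f] : PP a 1 0 B := by
  intro t η
  refine ⟨t, le_rfl, ?_⟩
  have : η = 0 := by
    apply Ext.postcomp_mk₀_injective_of_mono (Q a t) f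
    exact (hE _ _ _).trans (hE _ _ _).symm
  rw [this]; simp

def Tors {M : ModuleCat.{0} R} (m : M) : Prop := ∃ t, ∀ r ∈ a ^ t, r • m = 0

def qHom {M : ModuleCat.{0} R} (m : M) (t : ℕ) (h : ∀ r ∈ a ^ t, r • m = 0) : Q a t ⟶ M :=
  ModuleCat.ofHom (Submodule.liftQ _ (LinearMap.toSpanSingleton R M m) (by
    intro r hr; exact h r hr))

lemma qHom_one {M : ModuleCat.{0} R} (m : M) (t : ℕ) (h : ∀ r ∈ a ^ t, r • m = 0) :
    qHom a m t h (Submodule.Quotient.mk (1 : R)) = m := by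
  exact (Submodule.liftQ_apply _ _ _).trans (by simp)

lemma Q_hom_ext {M : ModuleCat.{0} R} {t : ℕ} (f g : Q a t ⟶ M)
    (h : f (Submodule.Quotient.mk (1 : R)) = g (Submodule.Quotient.mk (1 : R))) : f = g := by
  ext : 1
  apply Submodule.linearMap_qext
  ext
  exact h

lemma H4 {x : R} {M : ModuleCat.{0} R} (h : PP a x 0 M) (m : M) (hm : Tors a m) : x • m = 0 := by
  obtain ⟨t, ht⟩ := hm
  obtain ⟨s, hs, e⟩ := h t (Ext.mk₀ (qHom a m t ht))
  rw [← Ext.mk₀_smul, Ext.mk₀_comp_mk₀, Ext.mk₀_eq_zero_iff] at e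
  have := congrArg (fun f => f.hom (Submodule.Quotient.mk (1 : R))) e
  have h2 : (x • qHom a m t ht).hom (Submodule.Quotient.mk (1 : R)) = 0 := this
  rw [← qHom_one a m t ht]
  exact h2

/-- Local pieces. -/
structure LocP (l : List R) (E : ModuleCat.{0} R) where
  F : Fin l.length → ModuleCat.{0} R
  p : ∀ j, E ⟶ F j
  i : ∀ j, F j ⟶ E
  id_eq : 𝟙 E = ∑ j, p j ≫ i j
  iso : ∀ j, IsIso (l.get j • 𝟙 (F j))

lemma extZ_of_iso {F : ModuleCat.{0} R} {y : R} (hy : y ∈ a) (h : IsIso (y • 𝟙 F)) : ExtZ a F := by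
  intro t i e
  have key (k : ℕ) : ∃ g : F ⟶ F, (y ^ k • 𝟙 F) ≫ g = 𝟙 F := by
    induction k with
    | zero => exact ⟨𝟙 F, by simp⟩
    | succ k ih =>
      obtain ⟨g, hg⟩ := ih
      refine ⟨inv (y • 𝟙 F) ≫ g, ?_⟩
      have : y ^ (k+1) • 𝟙 F = (y ^ k • 𝟙 F) ≫ (y • 𝟙 F) := by
        rw [Linear.comp_smul, Linear.smul_comp, smul_smul, Category.comp_id, pow_succ, mul_comm]
      rw [this, Category.assoc, IsIso.hom_inv_id_assoc, hg]
  obtain ⟨g, hg⟩ := key t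
  have h0 : y ^ t • e = 0 := by
    have : (y ^ t • 𝟙 (Q a t)) = 0 := by
      apply Q_hom_ext
      change (y ^ t • (Submodule.Quotient.mk (1 : R)) : R ⧸ a ^ t) = 0
      rw [← Submodule.Quotient.mk_smul, Submodule.Quotient.mk_eq_zero]
      simpa using Ideal.pow_mem_pow hy t
    rw [← Ext.mk₀_id_comp e, ← Ext.smul_comp, ← Ext.mk₀_smul, this, Ext.mk₀_zero, Ext.zero_comp]
  rw [← Ext.comp_mk₀_id e, ← hg, ← Ext.mk₀_comp_mk₀, ← Ext.comp_assoc_of_third_deg_zero,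
    ← Ext.smul_eq_comp_mk₀, h0, Ext.zero_comp]

lemma LocP.extZ {l : List R} {E : ModuleCat.{0} R} (h : LocP l E) (hl : ∀ y ∈ l, y ∈ a) : ExtZ a E := by
  intro t i e
  rw [← Ext.comp_mk₀_id e, h.id_eq, Ext.mk₀_sum, Ext.comp_sum]
  apply Finset.sum_eq_zero
  intro j _
  rw [← Ext.mk₀_comp_mk₀, ← Ext.comp_assoc_of_third_deg_zero,
    extZ_of_iso a (hl _ (l.get_mem j)) (h.iso j) _ _ (e.comp (Ext.mk₀ (h.p j)) (add_zero i)),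
    Ext.zero_comp]

lemma exists_embed (l : List R) (M : ModuleCat.{0} R) :
    ∃ (E : ModuleCat.{0} R) (f : M ⟶ E), Nonempty (LocP l E) ∧
      ∀ m, f m = 0 → Tors (Ideal.ofList l) m := by
  let F (j : Fin l.length) : ModuleCat.{0} R :=
    ModuleCat.of R (LocalizedModule (Submonoid.powers (l.get j)) M)
  let E : ModuleCat.{0} R := ModuleCat.of R (∀ j, F j)
  let f : M ⟶ E := ModuleCat.ofHom (LinearMap.pi fun j =>
    LocalizedModule.mkLinearMap (Submonoid.powers (l.get j)) M)
  refine ⟨E, f, ⟨⟨F, fun j => ModuleCat.ofHom (LinearMap.proj j),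
    fun j => ModuleCat.ofHom (LinearMap.single R (fun j => F j) j), ?_, ?_⟩⟩, ?_⟩
  · refine ModuleCat.hom_ext (LinearMap.ext fun v => ?_)
    rw [ModuleCat.hom_sum, LinearMap.sum_apply]
    exact (Finset.univ_sum_single (M := fun j => F j) v).symm
  · intro j
    have := IsLocalizedModule.map_units (LocalizedModule.mkLinearMap (Submonoid.powers (l.get j)) M)
      ⟨l.get j, Submonoid.mem_powers _⟩
    rw [Module.End.isUnit_iff] at this
    rw [ConcreteCategory.isIso_iff_bijective]
    exact this
  · intro m hm
    have hj (j) : ∃ k, l.get j ^ k • m = 0 := by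
      have := congrFun hm j
      have := (IsLocalizedModule.eq_zero_iff (Submonoid.powers (l.get j))
        (LocalizedModule.mkLinearMap (Submonoid.powers (l.get j)) M)).1 this
      obtain ⟨⟨_, k, rfl⟩, h⟩ := this
      exact ⟨k, h⟩
    have hrad : Ideal.ofList l ≤ (Ideal.torsionOf R M m).radical := by
      rw [Ideal.span_le]
      intro y hy
      obtain ⟨j, rfl⟩ := List.get_of_mem hy
      obtain ⟨k, hk⟩ := hj j
      exact ⟨k, hk⟩
    classical
    obtain ⟨t, ht⟩ := Ideal.exists_pow_le_of_le_radical_of_fg hrad ⟨l.toFinset, by simp⟩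
    exact ⟨t, fun r hr => ht hr⟩

variable [IsNoetherianRing R]

/-- torsion submodule -/
def Gam (J : ModuleCat.{0} R) : Submodule R J where
  carrier := {m | Tors a m}
  add_mem' := by
    rintro m n ⟨s, hs⟩ ⟨t, ht⟩
    refine ⟨s + t, fun r hr => ?_⟩
    rw [smul_add, hs r (Ideal.pow_le_pow_right (by omega) hr),
      ht r (Ideal.pow_le_pow_right (by omega) hr), add_zero]
  zero_mem' := ⟨0, fun r _ => smul_zero r⟩
  smul_mem' := by
    rintro c m ⟨t, ht⟩
    exact ⟨t, fun r hr => by rw [smul_comm, ht r hr, smul_zero]⟩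

/-- finitely generated torsion is killed by one power -/
lemma fg_tors {N : Type} [AddCommGroup N] [Module R N] [Module.Finite R N] (J : ModuleCat.{0} R)
    (f : N →ₗ[R] Gam a J) : ∃ s, ∀ r ∈ a ^ s, ∀ n, r • f n = 0 := by
  obtain ⟨S, hS⟩ := (Module.Finite.fg_top : (⊤ : Submodule R N).FG)
  have h (n : N) : ∃ t, ∀ r ∈ a ^ t, r • f n = 0 := by
    obtain ⟨t, ht⟩ := (f n).2
    exact ⟨t, fun r hr => Subtype.ext (ht r hr)⟩
  choose t ht using h
  refine ⟨S.sup t, fun r hr n => ?_⟩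
  have hle : (⊤ : Submodule R N) ≤ LinearMap.ker (r • f) := by
    rw [← hS, Submodule.span_le]
    intro n hn
    exact ht n r (Ideal.pow_le_pow_right (Finset.le_sup hn) hr)
  exact hle (Submodule.mem_top (x := n))

lemma gam_injective (J : ModuleCat.{0} R) [Injective J] :
    Injective (ModuleCat.of R (Gam a J)) := by
  have hJ : Module.Injective R J := Module.injective_module_of_injective_object R J
  have : Module.Injective R (Gam a J) := by
    apply Module.Baer.injective
    intro b f
    obtain ⟨s, hs⟩ := fg_tors a J f
    obtain ⟨k, hk⟩ := Ideal.exists_pow_inf_eq_pow_smul a (M := R) b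
    have hk := hk (k + s) (by omega)
    have hz : ∀ r (hr : r ∈ b), r ∈ a ^ (k + s) → f ⟨r, hr⟩ = 0 := by
      intro r hr hr'
      have h1 : r ∈ a ^ s • b := by
        have : r ∈ a ^ (k+s) • (⊤ : Submodule R R) ⊓ b := ⟨by simpa using hr', hr⟩
        rw [hk, Nat.add_sub_cancel_left] at this
        exact Submodule.smul_mono le_rfl inf_le_right this
      have h2 : a ^ s • b ≤ (LinearMap.ker f).map b.subtype := by
        rw [Submodule.smul_le]
        intro u hu n hn
        exact ⟨⟨u • n, b.smul_mem _ hn⟩,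
          LinearMap.mem_ker.2 ((map_smul f u ⟨n, hn⟩).trans (hs u hu _)), rfl⟩
      obtain ⟨z, hz, rfl⟩ := h2 h1
      exact hz
    let q : b →ₗ[R] R ⧸ a ^ (k+s) := (Submodule.mkQ _) ∘ₗ b.subtype
    have hq : LinearMap.ker q ≤ LinearMap.ker f := by
      intro r hr
      exact hz r r.2 ((Submodule.Quotient.mk_eq_zero _).1 hr)
    let g : (b ⧸ LinearMap.ker q) →ₗ[R] J :=
      (Gam a J).subtype ∘ₗ (LinearMap.ker q).liftQ f hq
    let i : (b ⧸ LinearMap.ker q) →ₗ[R] R ⧸ a ^ (k+s) := (LinearMap.ker q).liftQ q le_rfl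
    have hi : Function.Injective i := by
      rw [← LinearMap.ker_eq_bot]
      exact Submodule.ker_liftQ_eq_bot _ _ _ le_rfl
    obtain ⟨G, hG⟩ := hJ.out i hi g
    refine ⟨LinearMap.codRestrict (Gam a J) (G ∘ₗ Submodule.mkQ _) (fun r => ⟨k + s, ?_⟩), ?_⟩
    · intro u hu
      rw [← map_smul]
      change G (Submodule.Quotient.mk (u • r)) = 0
      rw [(Submodule.Quotient.mk_eq_zero _).2, map_zero]
      exact Ideal.mul_mem_right _ _ hu
    · intro r hr
      apply Subtype.ext
      exact hG (Submodule.Quotient.mk ⟨r, hr⟩)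
  exact Module.injective_object_of_injective_module R _

lemma ses_of_mono {N E : ModuleCat.{0} R} (f : N ⟶ E) [Mono f] :
    (ShortComplex.mk f (cokernel.π f) (cokernel.condition f)).ShortExact where
  exact := ShortComplex.exact_cokernel f

lemma cokernel_tors {N E : ModuleCat.{0} R} (f : N ⟶ E) (h : ∀ m : E, Tors a m) :
    ∀ m : (cokernel f : ModuleCat.{0} R), Tors a m := by
  intro m
  obtain ⟨e, rfl⟩ := (ModuleCat.epi_iff_surjective (cokernel.π f)).1 inferInstance m
  obtain ⟨t, ht⟩ := h e
  exact ⟨t, fun r hr => by rw [← map_smul, ht r hr, map_zero]⟩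

lemma exists_inj (N : ModuleCat.{0} R) (hN : ∀ m : N, Tors a m) :
    ∃ (I : ModuleCat.{0} R) (f : N ⟶ I), Injective I ∧ Mono f ∧ ∀ m : I, Tors a m := by
  let J := Injective.under N
  let j : N ⟶ J := Injective.ι N
  let f : N ⟶ ModuleCat.of R (Gam a J) := ModuleCat.ofHom (LinearMap.codRestrict _ j.hom (fun m => by
    obtain ⟨t, ht⟩ := hN m
    exact ⟨t, fun r hr => by rw [← map_smul, ht r hr, map_zero]⟩))
  refine ⟨_, f, gam_injective a J, ?_, ?_⟩
  · rw [ModuleCat.mono_iff_injective]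
    intro m n h
    apply (ModuleCat.mono_iff_injective j).1 inferInstance
    exact congrArg Subtype.val h
  · rintro ⟨m, t, ht⟩
    exact ⟨t, fun r hr => Subtype.ext (ht r hr)⟩

lemma H3 (i : ℕ) : ∀ (N : ModuleCat.{0} R), (∀ m : N, Tors a m) → PP a 1 (i+1) N := by
  induction i with
  | zero =>
    intro N hN
    obtain ⟨I, f, hI, hf, hT⟩ := exists_inj a N hN
    have hS := ses_of_mono f
    intro t η
    obtain ⟨z, hz⟩ := Ext.covariant_sequence_exact₁ _ hS η (Ext.eq_zero_of_injective _) rfl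
    obtain ⟨g, rfl⟩ := (Ext.mk₀_bijective _ _).2 z
    obtain ⟨e, he⟩ := (ModuleCat.epi_iff_surjective (cokernel.π f)).1 inferInstance
      (g (Submodule.Quotient.mk (1 : R)))
    obtain ⟨s, hs⟩ := hT e
    have hs' : ∀ r ∈ a ^ (t + s), r • e = 0 := fun r hr => hs r (Ideal.pow_le_pow_right (by omega) hr)
    have hg : π a (Nat.le_add_right t s) ≫ g = qHom a e (t + s) hs' ≫ cokernel.π f := by
      apply Q_hom_ext
      refine Eq.trans ?_ (congrArg (cokernel.π f) (qHom_one a e (t+s) hs')).symm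
      rw [he]
      rfl
    refine ⟨t + s, Nat.le_add_right t s, ?_⟩
    rw [one_smul, ← hz, Ext.mk₀_comp_mk₀_assoc, hg, ← Ext.mk₀_comp_mk₀_assoc]
    have := hS.comp_extClass
    dsimp at this
    rw [this, Ext.comp_zero]
  | succ i ih =>
    intro N hN
    obtain ⟨I, f, hI, hf, hT⟩ := exists_inj a N hN
    exact H1' a (ses_of_mono f) (fun t e => Ext.eq_zero_of_injective e)
      (ih _ (cokernel_tors a f hT))
end RCM

end

section
open CategoryTheory Limits Opposite Pretriangulated

namespace RCM
universe v u
variable {R : Type} [CommRing R]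
section abs
variable {D : Type u} [Category.{v} D] [Preadditive D] [HasZeroObject D] [HasShift D ℤ]
  [∀ n : ℤ, (shiftFunctor D n).Additive] [Pretriangulated D] [Linear R D]
  [∀ n : ℤ, (shiftFunctor D n).Linear R]

/-- `x` kills `Hom(K, X[p])` -/
def Kills (x : R) (K X : D) (p : ℤ) : Prop := ∀ f : K ⟶ X⟦p⟧, x • f = 0

lemma S1 {T : Triangle D} (hT : T ∈ distTriang D) {K : D} {x : R} {p q : ℤ} (hpq : q + 1 = p)
    (h2 : Kills (1 : R) K T.obj₂ p) (h3 : Kills x K T.obj₃ q) : Kills x K T.obj₁ p := by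
  intro f
  let e (X : D) : X⟦p⟧ ≅ X⟦q⟧⟦(1:ℤ)⟧ := (shiftFunctorAdd' D q 1 p hpq).app X
  have hT' := Triangle.shift_distinguished T hT q
  have hz : ∀ g : K ⟶ T.obj₂⟦q⟧⟦(1:ℤ)⟧, g = 0 := by
    intro g
    have := h2 (g ≫ (e _).inv)
    rw [one_smul] at this
    rw [← cancel_mono (e T.obj₂).inv, this, zero_comp]
  obtain ⟨g, m, hg⟩ : ∃ (g : K ⟶ T.obj₃⟦q⟧) (m : T.obj₃⟦q⟧ ⟶ T.obj₁⟦q⟧⟦(1:ℤ)⟧),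
      f ≫ (e T.obj₁).hom = g ≫ m := by
    obtain ⟨g, hg⟩ := Triangle.coyoneda_exact₁ _ hT' (f ≫ (e T.obj₁).hom) (hz _)
    exact ⟨g, _, hg⟩
  have hg' : x • g = 0 := h3 g
  rw [← cancel_mono (e T.obj₁).hom, Linear.smul_comp, hg, ← Linear.smul_comp, hg', zero_comp, zero_comp]

lemma S2 {T : Triangle D} (hT : T ∈ distTriang D) {K : D} {x : R} {p : ℤ}
    (h1 : Kills x K T.obj₁ p) (h3 : Kills (1 : R) K T.obj₃ p) : Kills x K T.obj₂ p := by
  intro f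
  have hT' := Triangle.shift_distinguished T hT p
  have hz : ∀ g : K ⟶ T.obj₃⟦p⟧, g = 0 := fun g => by simpa using h3 g
  obtain ⟨g, m, hg⟩ : ∃ (g : K ⟶ T.obj₁⟦p⟧) (m : T.obj₁⟦p⟧ ⟶ T.obj₂⟦p⟧), f = g ≫ m := by
    obtain ⟨g, hg⟩ := Triangle.coyoneda_exact₂ _ hT' f (hz _)
    exact ⟨g, _, hg⟩
  have hg' : x • g = 0 := h1 g
  rw [hg, ← Linear.smul_comp, hg', zero_comp]

lemma smul_eq_comp {K X : D} {p : ℤ} (x : R) (f : K ⟶ X⟦p⟧) : x • f = f ≫ (x • 𝟙 X)⟦p⟧' := by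
  rw [Functor.map_smul, CategoryTheory.Functor.map_id, Linear.comp_smul, Category.comp_id]

lemma kills_of_zero {K X : D} {p : ℤ} {x : R} (h : x • 𝟙 X = 0) : Kills x K X p := by
  intro f
  rw [smul_eq_comp, h, Functor.map_zero, comp_zero]

lemma hom_shift_zero {K' X : D} {p q : ℤ} (hpq : q + 1 = p) (h : Kills (1:R) K' X q)
    (g : K'⟦(1:ℤ)⟧ ⟶ X⟦p⟧) : g = 0 := by
  let e (X : D) : X⟦p⟧ ≅ X⟦q⟧⟦(1:ℤ)⟧ := (shiftFunctorAdd' D q 1 p hpq).app X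
  obtain ⟨g0, hg⟩ := (shiftFunctor D (1:ℤ)).map_surjective (g ≫ (e X).hom)
  have : g0 = 0 := by simpa using h g0
  rw [← cancel_mono (e X).hom, ← hg, this, Functor.map_zero, zero_comp]

variable {K' K : D} {y : R} {i : K' ⟶ K} {j : K ⟶ K'⟦(1:ℤ)⟧}

lemma cone_vanish (hT : Triangle.mk (y • 𝟙 K') i j ∈ distTriang D) {X : D} {p q : ℤ} (hpq : q + 1 = p)
    (h1 : Kills (1:R) K' X p) (h2 : Kills (1:R) K' X q) : Kills (1:R) K X p := by
  intro f
  rw [one_smul]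
  have h0 : i ≫ f = 0 := by simpa using h1 (i ≫ f)
  obtain ⟨g, hg⟩ : ∃ g : K'⟦(1:ℤ)⟧ ⟶ X⟦p⟧, f = j ≫ g := Triangle.yoneda_exact₃ _ hT f h0
  rw [hg, hom_shift_zero hpq h2 g, comp_zero]

lemma smul_cone₁ (hT : Triangle.mk (y • 𝟙 K') i j ∈ distTriang D) : y • i = 0 := by
  have h : (y • 𝟙 K') ≫ i = 0 := comp_distTriang_mor_zero₁₂ _ hT
  rwa [Linear.smul_comp, Category.id_comp] at h

lemma smul_cone₃ (hT : Triangle.mk (y • 𝟙 K') i j ∈ distTriang D) : y • j = 0 := by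
  have h : j ≫ (y • 𝟙 K')⟦(1:ℤ)⟧' = 0 := comp_distTriang_mor_zero₃₁ _ hT
  rwa [Functor.map_smul, CategoryTheory.Functor.map_id, Linear.comp_smul, Category.comp_id] at h

lemma cone_inv (hT : Triangle.mk (y • 𝟙 K') i j ∈ distTriang D) {X : D} {p : ℤ}
    (hX : IsIso (y • 𝟙 X)) : Kills (1:R) K X p := by
  intro f
  rw [one_smul]
  have e1 {L : D} (f : L ⟶ X⟦p⟧) : f = y • (f ≫ (inv (y • 𝟙 X))⟦p⟧') := by
    rw [← Linear.smul_comp, smul_eq_comp, Category.assoc, ← Functor.map_comp, IsIso.hom_inv_id,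
      CategoryTheory.Functor.map_id, Category.comp_id]
  have h0 : i ≫ f = 0 := by
    rw [e1 f, Linear.comp_smul, ← Linear.smul_comp, smul_cone₁ hT, zero_comp]
  obtain ⟨g, hg⟩ : ∃ g : K'⟦(1:ℤ)⟧ ⟶ X⟦p⟧, f = j ≫ g := Triangle.yoneda_exact₃ _ hT f h0
  rw [hg, e1 g, Linear.comp_smul, ← Linear.smul_comp, smul_cone₃ hT, zero_comp]

lemma cone_top (hT : Triangle.mk (y • 𝟙 K') i j ∈ distTriang D) {X : D} {p q : ℤ} (hpq : q + 1 = p)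
    (h1 : Kills (1:R) K' X p) (x : R) (b : Ideal R)
    (h : ∀ ψ : K ⟶ X⟦p⟧, x • ψ ∈ b • (⊤ : Submodule R (K ⟶ X⟦p⟧))) (φ : K' ⟶ X⟦q⟧) :
    x • φ ∈ (b ⊔ Ideal.span {y}) • (⊤ : Submodule R (K' ⟶ X⟦q⟧)) := by
  let e : X⟦p⟧ ≅ X⟦q⟧⟦(1:ℤ)⟧ := (shiftFunctorAdd' D q 1 p hpq).app X
  let Θ : (K' ⟶ X⟦q⟧) →ₗ[R] (K ⟶ X⟦p⟧) :=
    { toFun := fun φ => j ≫ φ⟦(1:ℤ)⟧' ≫ e.inv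
      map_add' := by intro f g; simp [Functor.map_add]
      map_smul' := by intro r f; simp [Functor.map_smul] }
  have hsurj : Function.Surjective Θ := by
    intro f
    have h0 : i ≫ f = 0 := by simpa using h1 (i ≫ f)
    obtain ⟨g, hg⟩ : ∃ g : K'⟦(1:ℤ)⟧ ⟶ X⟦p⟧, f = j ≫ g := Triangle.yoneda_exact₃ _ hT f h0
    obtain ⟨g0, hg0⟩ := (shiftFunctor D (1:ℤ)).map_surjective (g ≫ e.hom)
    refine ⟨g0, ?_⟩
    change j ≫ g0⟦(1:ℤ)⟧' ≫ e.inv = f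
    rw [hg0, hg]
    simp
  have hker : ∀ φ, Θ φ = 0 → φ ∈ (Ideal.span {y}) • (⊤ : Submodule R (K' ⟶ X⟦q⟧)) := by
    intro φ hφ
    have hφ' : j ≫ φ⟦(1:ℤ)⟧' = 0 := by
      rw [← cancel_mono e.inv, Category.assoc, zero_comp]; exact hφ
    obtain ⟨g, hg⟩ : ∃ g : K'⟦(1:ℤ)⟧ ⟶ X⟦q⟧⟦(1:ℤ)⟧, φ⟦(1:ℤ)⟧' = (-((y • 𝟙 K')⟦(1:ℤ)⟧')) ≫ g :=
      Triangle.yoneda_exact₃ _ (rot_of_distTriang _ hT) (φ⟦(1:ℤ)⟧') hφ'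
    obtain ⟨g0, hg0⟩ := (shiftFunctor D (1:ℤ)).map_surjective g
    have : φ = y • (- g0) := by
      apply (shiftFunctor D (1:ℤ)).map_injective
      rw [hg, ← hg0]
      simp [Functor.map_smul]
    rw [this]
    exact Submodule.smul_mem_smul (Ideal.mem_span_singleton_self y) trivial
  have h2 := h (Θ φ)
  have h3 : b • (⊤ : Submodule R (K ⟶ X⟦p⟧)) = (b • (⊤ : Submodule R (K' ⟶ X⟦q⟧))).map Θ := by
    rw [Submodule.map_smul'', Submodule.map_top, LinearMap.range_eq_top.2 hsurj]
  rw [h3] at h2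
  obtain ⟨z, hz, hz'⟩ := h2
  have h4 := hker (x • φ - z) (by rw [map_sub, map_smul, hz', sub_self])
  rw [Submodule.sup_smul]
  rw [← add_sub_cancel z (x • φ)]
  exact Submodule.add_mem_sup hz h4
end abs
end RCM

end

section
open CategoryTheory Limits Opposite Pretriangulated

namespace RCM
universe w
variable {R : Type} [CommRing R]

noncomputable section good
variable [HasDerivedCategory.{w} (ModuleCat.{0} R)]

/-- the derived category -/
abbrev DD (R : Type) [CommRing R] [HasDerivedCategory.{w} (ModuleCat.{0} R)] := DerivedCategory (ModuleCat.{0} R)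

/-- degree zero embedding -/
abbrev Sing (M : ModuleCat.{0} R) : DD R := (DerivedCategory.singleFunctor (ModuleCat.{0} R) 0).obj M

/-- Koszul-like objects -/
structure Good (l : List R) (K : DD R) : Prop where
  neg : ∀ (M : ModuleCat.{0} R) (p : ℤ), p < 0 → Kills (1:R) K (Sing M) p
  pos : ∀ (M : ModuleCat.{0} R) (p : ℤ), (l.length : ℤ) < p → Kills (1:R) K (Sing M) p
  inv : ∀ (F : ModuleCat.{0} R) (y : R), y ∈ l → IsIso (y • 𝟙 F) → ∀ p, Kills (1:R) K (Sing F) p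
  top : ∀ (b : Ideal R) (x : R) (M : ModuleCat.{0} R),
    (∀ ψ : K ⟶ (Sing M)⟦(l.length : ℤ)⟧, x • ψ ∈ b • (⊤ : Submodule R (K ⟶ (Sing M)⟦(l.length : ℤ)⟧))) →
    ∀ m : M, x • m ∈ (b ⊔ Ideal.ofList l) • (⊤ : Submodule R M)

lemma good_nil : Good ([] : List R) (Sing (ModuleCat.of R R)) where
  neg M p hp f := by
    rw [one_smul]
    have : (DerivedCategory.TStructure.t (C := ModuleCat.{0} R)).IsGE ((Sing M)⟦p⟧) (-p) :=
      (DerivedCategory.TStructure.t).isGE_shift _ 0 p (-p) (by omega)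
    exact (DerivedCategory.TStructure.t).zero f 0 (-p) (by omega)
  pos M p hp f := by
    have : Projective (ModuleCat.of R R) := inferInstance
    rw [one_smul]
    obtain ⟨n, rfl⟩ : ∃ n : ℕ, p = ((n + 1 : ℕ) : ℤ) := by
      have : (0 : ℤ) < p := by simpa using hp
      exact ⟨(p - 1).toNat, by omega⟩
    let e := Abelian.Ext.homEquiv (X := ModuleCat.of R R) (Y := M) (n := n + 1)
    obtain ⟨α, hα⟩ := e.surjective f
    have h0 : α = 0 := Abelian.Ext.eq_zero_of_projective α
    rw [← hα, h0]
    exact Abelian.Ext.zero_hom _ _ _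
  inv F y hy := by simp at hy
  top b x M h m := by
    let S := DerivedCategory.singleFunctor (ModuleCat.{0} R) 0
    let e := (shiftFunctorZero (DD R) ℤ).app (Sing M)
    let Θ : (Sing (ModuleCat.of R R) ⟶ (Sing M)⟦(([] : List R).length : ℤ)⟧) →ₗ[R] M :=
      { toFun := fun ψ => (S.preimage (ψ ≫ e.hom)).hom (1 : R)
        map_add' := by
          intro f g
          have : S.preimage ((f + g) ≫ e.hom) = S.preimage (f ≫ e.hom) + S.preimage (g ≫ e.hom) := by
            apply S.map_injective
            simp [Functor.map_add, Preadditive.add_comp]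
          rw [this]; rfl
        map_smul' := by
          intro r f
          have : S.preimage ((r • f) ≫ e.hom) = r • S.preimage (f ≫ e.hom) := by
            apply S.map_injective
            simp [Functor.map_smul, Linear.smul_comp]
          rw [this]; rfl }
    let g : ModuleCat.of R R ⟶ M := ModuleCat.ofHom (LinearMap.toSpanSingleton R M m)
    have hm : Θ (S.map g ≫ e.inv) = m := by
      change (S.preimage ((S.map g ≫ e.inv) ≫ e.hom)).hom (1 : R) = m
      rw [Category.assoc, Iso.inv_hom_id, Category.comp_id, S.preimage_map]
      exact one_smul R m
    have h1 := Submodule.mem_map_of_mem (f := Θ) (h (S.map g ≫ e.inv))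
    rw [Submodule.map_smul'', map_smul, hm] at h1
    exact Submodule.smul_mono le_sup_left le_top h1

lemma isIso_sing {F : ModuleCat.{0} R} {y : R} (h : IsIso (y • 𝟙 F)) : IsIso (y • 𝟙 (Sing F)) := by
  have : (DerivedCategory.singleFunctor (ModuleCat.{0} R) 0).map (y • 𝟙 F) = y • 𝟙 (Sing F) := by
    rw [Functor.map_smul, CategoryTheory.Functor.map_id]
  rw [← this]; infer_instance

lemma good_cons {l : List R} {K' : DD R} (h : Good l K') (y : R) : ∃ K, Good (y :: l) K := by
  obtain ⟨K, i, j, hT⟩ := distinguished_cocone_triangle (y • 𝟙 K')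
  refine ⟨K, ?_, ?_, ?_, ?_⟩
  · intro M p hp
    exact cone_vanish hT (q := p - 1) (by omega) (h.neg M p hp) (h.neg M _ (by omega))
  · intro M p hp
    have hp : (l.length : ℤ) + 1 < p := by simpa using hp
    exact cone_vanish hT (q := p - 1) (by omega) (h.pos M p (by omega)) (h.pos M _ (by omega))
  · intro F z hz hF p
    rcases List.mem_cons.1 hz with rfl | hz
    · exact cone_inv hT (isIso_sing hF)
    · exact cone_vanish hT (q := p - 1) (by omega) (h.inv F z hz hF _) (h.inv F z hz hF _)
  · intro b x M hψ m
    have := h.top (b ⊔ Ideal.span {y}) x M (cone_top hT (p := ((y :: l).length : ℤ)) (by simp)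
      (h.pos M _ (by simp)) x b hψ) m
    rwa [sup_assoc, ← Ideal.ofList_cons] at this

lemma exists_good (l : List R) : ∃ K, Good l K := by
  induction l with
  | nil => exact ⟨_, good_nil⟩
  | cons y l ih => obtain ⟨K', h⟩ := ih; exact good_cons h y

lemma isIso_pow {F : ModuleCat.{0} R} {y : R} (h : IsIso (y • 𝟙 F)) (n : ℕ) : IsIso (y ^ n • 𝟙 F) := by
  induction n with
  | zero => rw [pow_zero, one_smul]; infer_instance
  | succ n ih =>
    have : y ^ (n+1) • 𝟙 F = (y ^ n • 𝟙 F) ≫ (y • 𝟙 F) := by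
      rw [Linear.comp_smul, Linear.smul_comp, smul_smul, Category.comp_id, pow_succ, mul_comm]
    rw [this]; infer_instance

lemma good_locP {l : List R} {n : ℕ} {K : DD R} (h : Good (l.map (· ^ n)) K) {E : ModuleCat.{0} R}
    (hE : LocP l E) (p : ℤ) : Kills (1:R) K (Sing E) p := by
  intro f
  have e : 𝟙 (Sing E) = ∑ j, (DerivedCategory.singleFunctor (ModuleCat.{0} R) 0).map (hE.p j) ≫
      (DerivedCategory.singleFunctor (ModuleCat.{0} R) 0).map (hE.i j) := by
    rw [← CategoryTheory.Functor.map_id, hE.id_eq, Functor.map_sum]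
    simp
  have e2 : f = ∑ j, (f ≫ ((DerivedCategory.singleFunctor (ModuleCat.{0} R) 0).map (hE.p j))⟦p⟧') ≫
      ((DerivedCategory.singleFunctor (ModuleCat.{0} R) 0).map (hE.i j))⟦p⟧' := by
    conv_lhs => rw [← Category.comp_id f, ← CategoryTheory.Functor.map_id, e, Functor.map_sum, Preadditive.comp_sum]
    simp
  rw [one_smul, e2]
  apply Finset.sum_eq_zero
  intro j _
  have := h.inv (hE.F j) (l.get j ^ n) (List.mem_map.2 ⟨_, l.get_mem j, rfl⟩) (isIso_pow (hE.iso j) n) p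
    (f ≫ ((DerivedCategory.singleFunctor (ModuleCat.{0} R) 0).map (hE.p j))⟦p⟧')
  rw [one_smul] at this
  rw [this, zero_comp]

end good
end RCM

end

section
open CategoryTheory Limits Opposite Pretriangulated

namespace RCM
universe w
variable {R : Type} [CommRing R]

noncomputable section main
variable [HasDerivedCategory.{w} (ModuleCat.{0} R)]

section fixed
variable {l : List R} {n : ℕ} {K : DD R}

lemma T1 {S : ShortComplex (ModuleCat.{0} R)} (hS : S.ShortExact) {x : R} {p : ℤ}
    (h2 : Kills (1 : R) K (Sing S.X₂) p) (h3 : Kills x K (Sing S.X₃) (p-1)) :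
    Kills x K (Sing S.X₁) p :=
  S1 hS.singleTriangle_distinguished (q := p - 1) (by omega) h2 h3

lemma T2 {S : ShortComplex (ModuleCat.{0} R)} (hS : S.ShortExact) {x : R} {p : ℤ}
    (h1 : Kills x K (Sing S.X₁) p) (h3 : Kills (1:R) K (Sing S.X₃) p) :
    Kills x K (Sing S.X₂) p :=
  S2 hS.singleTriangle_distinguished h1 h3

variable [IsNoetherianRing R]

lemma exists_mono (l : List R) (M : ModuleCat.{0} R) (h : PP (Ideal.ofList l) 1 0 M) :
    ∃ (E : ModuleCat.{0} R) (f : M ⟶ E), Nonempty (LocP l E) ∧ Mono f := by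
  obtain ⟨E, f, hE, hf⟩ := exists_embed l M
  refine ⟨E, f, hE, ?_⟩
  rw [ModuleCat.mono_iff_injective]
  refine (injective_iff_map_eq_zero f.hom).2 fun m hm => ?_
  simpa using H4 _ h m (hf m hm)

lemma LocP.extZ' {E : ModuleCat.{0} R} (h : LocP l E) : ExtZ (Ideal.ofList l) E :=
  h.extZ _ (fun y hy => Ideal.subset_span hy)

lemma lemB (hK : Good (l.map (· ^ n)) K) (k : ℕ) : ∀ (B : ModuleCat.{0} R)
    (_ : ∀ i, PP (Ideal.ofList l) 1 i B) (p : ℤ) (_ : p < k), Kills (1:R) K (Sing B) p := by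
  induction k with
  | zero => intro B hB p hp; exact hK.neg B p (by simpa using hp)
  | succ k ih =>
    intro B hB p hp
    obtain ⟨E, f, ⟨hE⟩, hf⟩ := exists_mono l B (hB 0)
    have hS := ses_of_mono f
    refine T1 hS (good_locP hK hE p) (ih _ (fun i => ?_) _ (by push_cast at hp; omega))
    exact H1 _ hS hE.extZ' (hB (i+1))

lemma mainInd (hK : Good (l.map (· ^ n)) K) (x : R) (c : ℕ) : ∀ (M : ModuleCat.{0} R)
    (_ : ∀ i, i ≠ c → PP (Ideal.ofList l) 1 i M) (_ : PP (Ideal.ofList l) x c M) (p : ℤ),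
    Kills x K (Sing M) p := by
  induction c with
  | zero =>
    intro M hM hx p
    obtain ⟨E, f, ⟨hE⟩, hf⟩ := exists_embed l M
    have hS := ses_of_mono (kernel.ι f)
    have hinj : Function.Injective (kernel.ι f) := (ModuleCat.mono_iff_injective _).1 inferInstance
    have ht (m : (kernel f : ModuleCat.{0} R)) : Tors (Ideal.ofList l) (kernel.ι f m) :=
      hf _ (congrArg (fun g => g.hom m) (kernel.condition f))
    have ht' (m : (kernel f : ModuleCat.{0} R)) : Tors (Ideal.ofList l) m := by
      obtain ⟨t, h⟩ := ht m
      exact ⟨t, fun r hr => hinj (by rw [map_smul, h r hr, map_zero])⟩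
    refine T2 hS (kills_of_zero ?_) (lemB hK (p.toNat + 1) _ ?_ p (by omega))
    · have : x • 𝟙 (kernel f) = 0 := by
        refine ModuleCat.hom_ext (LinearMap.ext fun m => ?_)
        change x • m = 0
        exact hinj (by rw [map_smul, H4 _ hx _ (ht m), map_zero])
      change x • 𝟙 (Sing (kernel f)) = 0
      rw [← CategoryTheory.Functor.map_id, ← Functor.map_smul, this, Functor.map_zero]
    · intro i
      rcases Nat.eq_zero_or_pos i with rfl | hi
      · exact H5 _ hE.extZ' (Abelian.factorThruCoimage f)
      · exact H2 _ hS (hM i (by omega)) (H3 _ i _ ht')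
  | succ c ih =>
    intro M hM hx p
    obtain ⟨E, f, ⟨hE⟩, hf⟩ := exists_mono l M (hM 0 (by omega))
    have hS := ses_of_mono f
    exact T1 hS (good_locP hK hE p) (ih _ (fun i hi => H1 _ hS hE.extZ' (hM _ (by omega)))
      (H1 _ hS hE.extZ' hx) _)

end fixed
end main

lemma pow_list (l : List R) (n : ℕ) : Ideal.ofList (l.map (· ^ n)) ≤ Ideal.ofList l ^ n := by
  refine Ideal.span_le.2 ?_
  intro z hz
  obtain ⟨y, hy, rfl⟩ := List.mem_map.1 hz
  have h1 : y ∈ Ideal.ofList l := Ideal.subset_span hy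
  exact Ideal.pow_mem_pow h1 n

lemma key [IsNoetherianRing R] [IsLocalRing R] (a : Ideal R) (ha : a ≠ ⊤) (M : ModuleCat.{0} R)
    [Module.Finite R M] (c : ℕ) (x : R) (h : ∀ i, i ≠ c → PP a 1 i M) (hx : PP a x c M) (m : M) :
    x • m = 0 := by
  letI := HasDerivedCategory.standard (ModuleCat.{0} R)
  obtain ⟨S, rfl⟩ : a.FG := IsNoetherian.noetherian a
  obtain ⟨l, hl⟩ : ∃ l : List R, Ideal.span (S : Set R) = Ideal.ofList l :=
    ⟨S.toList, by simp [Ideal.ofList]⟩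
  change Ideal.span (S : Set R) ≠ ⊤ at ha
  change ∀ i, i ≠ c → PP (Ideal.span (S : Set R)) 1 i M at h
  change PP (Ideal.span (S : Set R)) x c M at hx
  rw [hl] at ha h hx
  have h1 (n : ℕ) : x • m ∈ Ideal.ofList l ^ n • (⊤ : Submodule R M) := by
    obtain ⟨K, hK⟩ := exists_good (l.map (· ^ n))
    have := hK.top ⊥ x M (fun ψ => by
      rw [mainInd hK x c M h hx _ ψ]; exact Submodule.zero_mem _) m
    rw [bot_sup_eq] at this
    exact Submodule.smul_mono (pow_list l n) le_rfl this
  have := Ideal.iInf_pow_smul_eq_bot_of_isLocalRing (M := M) (Ideal.ofList l) ha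
  rw [← Submodule.mem_bot R, ← this]
  exact (Submodule.mem_iInf _).2 h1

lemma PP_top (i : ℕ) (M : ModuleCat.{0} R) : PP (⊤ : Ideal R) 1 i M := by
  intro t η
  refine ⟨t, le_rfl, ?_⟩
  have : π (⊤ : Ideal R) (le_refl t) = 0 := by
    apply Q_hom_ext
    refine (Submodule.Quotient.mk_eq_zero _).2 ?_
    rw [Ideal.top_pow]; trivial
  rw [this, Abelian.Ext.mk₀_zero, Abelian.Ext.zero_comp]

lemma ann_sub (a : Ideal R) (M : ModuleCat.{0} R) (c : ℕ) (T : Submodule R M) (x : R)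
    (hx : ∀ m : M, x • m ∈ T) (hT : PP a 1 c (ModuleCat.of R T)) : PP a x c M := by
  intro t η
  let f : M ⟶ ModuleCat.of R T := ModuleCat.ofHom
    (LinearMap.codRestrict T (x • LinearMap.id) hx)
  let ι : ModuleCat.of R T ⟶ M := ModuleCat.ofHom T.subtype
  have hf : f ≫ ι = x • 𝟙 M := rfl
  obtain ⟨s, hs, e⟩ := hT t (η.comp (Abelian.Ext.mk₀ f) (add_zero c))
  refine ⟨s, hs, ?_⟩
  have e1 : x • η = (η.comp (Abelian.Ext.mk₀ f) (add_zero c)).comp (Abelian.Ext.mk₀ ι) (add_zero c) := by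
    rw [Abelian.Ext.comp_assoc_of_third_deg_zero, Abelian.Ext.mk₀_comp_mk₀, hf, Abelian.Ext.smul_eq_comp_mk₀]
  rw [one_smul] at e
  rw [e1, ← Abelian.Ext.comp_assoc_of_third_deg_zero, e, Abelian.Ext.zero_comp]

end RCM


end

theorem stmt9 {R : Type} [CommRing R] [IsNoetherianRing R] [IsLocalRing R]
    (a : Ideal R) (M : ModuleCat R) [Module.Finite R M] (hM : Nontrivial M)
    (c : ℕ) (hcd : HasCD a M c)
    (hrcm : ∀ i, i ≠ c → Subsingleton ((localCohomology a i).obj M))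
    (T : Submodule R M)
    (hT : IsGreatest {N : Submodule R M |
      ∀ i, c ≤ i → Subsingleton ((localCohomology a i).obj (ModuleCat.of R N))} T) :
    Module.annihilator R ((localCohomology a c).obj M) =
        Module.annihilator R (M ⧸ T) ∧
      Module.annihilator R (M ⧸ T) = Module.annihilator R M := by
  have ha : a ≠ ⊤ := by
    rintro rfl
    exact not_subsingleton_iff_nontrivial.2 hcd.1
      ((RCM.subsingleton_iff _ c M).2 (RCM.PP_top c M))
  have h1 : Module.annihilator R ((localCohomology a c).obj M) ≤ Module.annihilator R M := by
    intro x hx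
    exact Module.mem_annihilator.2 (RCM.key a ha M c x
      (fun i hi => (RCM.subsingleton_iff a i M).1 (hrcm i hi)) ((RCM.mem_ann_iff a x c M).1 hx))
  have h2 : Module.annihilator R M ≤ Module.annihilator R (M ⧸ T) :=
    LinearMap.annihilator_le_of_surjective T.mkQ T.mkQ_surjective
  have h3 : Module.annihilator R (M ⧸ T) ≤ Module.annihilator R ((localCohomology a c).obj M) := by
    intro x hx
    rw [RCM.mem_ann_iff]
    refine RCM.ann_sub a M c T x (fun m => ?_) ((RCM.subsingleton_iff a c _).1 (hT.1 c le_rfl))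
    have := Module.mem_annihilator.1 hx (Submodule.Quotient.mk m)
    rwa [← Submodule.Quotient.mk_smul, Submodule.Quotient.mk_eq_zero] at this
  exact ⟨le_antisymm (h1.trans h2) h3, le_antisymm (h3.trans h1) h2⟩
end

section
/- Let (R, 𝔪) be a Noetherian local ring, 𝔞 an ideal generated by an M-regular sequence of length n, where M is a nonzero finitely generated R-module. Then Ann_R(H^n_𝔞(M)) = Ann_R(M/T_R(𝔞, M)) = Ann_R(M). -/
open CategoryTheory

open CategoryTheory.Limits

section bridge
variable {D : Type*} [Category D] [Abelian D]

lemma aux_center (z : 𝟭 D ⟶ 𝟭 D) {K : ChainComplex D ℕ} (φ : K ⟶ K) (n : ℕ)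
    (h : φ.f n = z.app (K.X n)) : HomologicalComplex.homologyMap φ n = z.app (K.homology n) := by
  rw [← cancel_mono (K.homologyι n), HomologicalComplex.homologyι_naturality]
  have : HomologicalComplex.opcyclesMap φ n = z.app (K.opcycles n) := by
    rw [← cancel_epi (K.pOpcycles n), HomologicalComplex.p_opcyclesMap, h]
    exact (z.naturality (K.pOpcycles n)).symm
  rw [this]
  exact (z.naturality _)

lemma aux_vanish {K : ChainComplex D ℕ} {I : D} [Injective I] (n : ℕ) (k : K.X n ⟶ I)
    (hk : K.d (n+1) n ≫ k = 0)
    (h : K.homologyι n ≫ K.descOpcycles k (n+1) (by simp) hk = 0) :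
    (n = 0 ∧ k = 0) ∨ ∃ p, ∃ _ : p + 1 = n, ∃ g : K.X p ⟶ I, K.d n p ≫ g = k := by
  cases n with
  | zero =>
    left
    refine ⟨rfl, ?_⟩
    rw [← K.p_descOpcycles k 1 (by simp) hk]
    have := (cancel_epi (K.homologyι 0)).1 (h.trans comp_zero.symm)
    rw [this, comp_zero]
  | succ p =>
    right
    refine ⟨p, rfl, ?_⟩
    let S := ShortComplex.mk (K.homologyι (p+1)) (K.fromOpcycles (p+1) p) (by simp)
    have hS : S.Exact := S.exact_of_f_is_kernel (K.homologyIsKernel (p+1) p (by simp))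
    refine ⟨hS.descToInjective _ h, ?_⟩
    have := hS.comp_descToInjective _ h
    rw [← K.p_fromOpcycles (p+1) p, Category.assoc]
    exact (congrArg (fun q => K.pOpcycles (p+1) ≫ q) this).trans
      (K.p_descOpcycles k (p+2) (by simp) hk)

lemma aux_nat {K L : ChainComplex D ℕ} {I : D} (φ : K ⟶ L) (n : ℕ) (k : L.X n ⟶ I)
    (hk : L.d (n+1) n ≫ k = 0) (k' : K.X n ⟶ I) (hk' : K.d (n+1) n ≫ k' = 0)
    (h : φ.f n ≫ k = k') :
    HomologicalComplex.homologyMap φ n ≫ L.homologyι n ≫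
      L.descOpcycles k (n+1) (by simp) hk =
    K.homologyι n ≫ K.descOpcycles k' (n+1) (by simp) hk' := by
  subst h
  rw [HomologicalComplex.homologyι_naturality_assoc,
    HomologicalComplex.opcyclesMap_comp_descOpcycles]
end bridge

section
variable {R : Type} [CommRing R]
abbrev EF (R : Type) [CommRing R] (Y : ModuleCat.{0} R) : ModuleCat.{0} R ⥤ (ModuleCat.{0} R)ᵒᵖ :=
  ((linearYoneda R (ModuleCat.{0} R)).obj Y).rightOp

noncomputable abbrev PR (X : ModuleCat.{0} R) : ProjectiveResolution X := projectiveResolution X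

/-- elements of `P_n ⟶ Y` as a morphism to `op R`. -/
noncomputable def toK {Y P : ModuleCat.{0} R} (f : P ⟶ Y) :
    (EF R Y).obj P ⟶ Opposite.op (ModuleCat.of R R) :=
  Quiver.Hom.op (ModuleCat.ofHom (LinearMap.toSpanSingleton R (P ⟶ Y) f) :
    ModuleCat.of R R ⟶ ModuleCat.of R (P ⟶ Y))

lemma toK_comp {Y P Q : ModuleCat.{0} R} (f : P ⟶ Y) (g : Q ⟶ P) :
    (EF R Y).map g ≫ toK f = toK (g ≫ f) := by
  apply Quiver.Hom.unop_inj
  apply ModuleCat.hom_ext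
  apply LinearMap.ext_ring
  change g ≫ ((1 : R) • f) = (1 : R) • (g ≫ f)
  simp

lemma toK_zero {Y P : ModuleCat.{0} R} : toK (0 : P ⟶ Y) = 0 := by
  apply Quiver.Hom.unop_inj
  apply ModuleCat.hom_ext
  apply LinearMap.ext_ring
  change ((1 : R) • (0 : P ⟶ Y)) = 0
  simp

lemma toK_surj {Y P : ModuleCat.{0} R} (k : (EF R Y).obj P ⟶ Opposite.op (ModuleCat.of R R)) :
    ∃ f : P ⟶ Y, toK f = k := by
  refine ⟨(k.unop.hom (1:R) : (P ⟶ Y)), ?_⟩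
  apply Quiver.Hom.unop_inj
  apply ModuleCat.hom_ext
  apply LinearMap.ext_ring
  exact one_smul R (k.unop.hom (1:R) : (P ⟶ Y))

lemma toK_inj {Y P : ModuleCat.{0} R} {f g : P ⟶ Y} (h : toK f = toK g) : f = g := by
  have := congrArg (fun k => (k.unop.hom (1:R) : (P ⟶ Y))) h
  exact (one_smul R f).symm.trans (Eq.trans this (one_smul R g))

noncomputable def clsHom {X Y : ModuleCat.{0} R} (n : ℕ) (f : (PR X).complex.X n ⟶ Y)
    (hf : (PR X).complex.d (n+1) n ≫ f = 0) :
    ((EF R Y).leftDerived n).obj X ⟶ Opposite.op (ModuleCat.of R R) :=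
  ((PR X).isoLeftDerivedObj (EF R Y) n).hom ≫
    HomologicalComplex.homologyι (((EF R Y).mapHomologicalComplex _).obj (PR X).complex) n ≫
    HomologicalComplex.descOpcycles _ (toK f) (n+1) (by simp) (by
      refine (toK_comp _ _).trans ?_
      rw [hf]
      exact toK_zero)

lemma clsHom_vanish {X Y : ModuleCat.{0} R} (n : ℕ) (f : (PR X).complex.X n ⟶ Y)
    (hf : (PR X).complex.d (n+1) n ≫ f = 0) (h : clsHom n f hf = 0) :
    (n = 0 ∧ f = 0) ∨ ∃ p, ∃ _ : p + 1 = n, ∃ g : (PR X).complex.X p ⟶ Y,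
      (PR X).complex.d n p ≫ g = f := by
  have hp : Projective (ModuleCat.of R R) := inferInstance
  rw [clsHom, ← cancel_epi ((PR X).isoLeftDerivedObj (EF R Y) n).inv] at h
  rw [Iso.inv_hom_id_assoc, comp_zero] at h
  rcases aux_vanish n _ _ h with ⟨h0, h1⟩ | ⟨p, hp, g, hg⟩
  · exact Or.inl ⟨h0, toK_inj (h1.trans toK_zero.symm)⟩
  · obtain ⟨g, rfl⟩ := toK_surj g
    exact Or.inr ⟨p, hp, g, toK_inj ((toK_comp _ _).symm.trans hg)⟩

lemma clsHom_nat {X X' Y : ModuleCat.{0} R} (n : ℕ) (f : (PR X).complex.X n ⟶ Y)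
    (hf : (PR X).complex.d (n+1) n ≫ f = 0) (u : X' ⟶ X)
    (φ : ProjectiveResolution.Hom (PR X') (PR X) u) :
    ((EF R Y).leftDerived n).map u ≫ clsHom n f hf =
      clsHom n (φ.hom.f n ≫ f) (by simp [← φ.hom.comm_assoc, hf]) := by
  rw [clsHom, clsHom, ← Category.assoc,
    ProjectiveResolution.isoLeftDerivedObj_hom_naturality u (PR X') (PR X) φ.hom
      φ.hom_f_zero_comp_π_f_zero]
  rw [Category.assoc]
  congr 1
  exact aux_nat (((EF R Y).mapHomologicalComplex _).map φ.hom) n (toK f) _ _ _ (toK_comp _ _)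

lemma clsHom_natY {X Y Y' : ModuleCat.{0} R} (n : ℕ) (f : (PR X).complex.X n ⟶ Y)
    (hf : (PR X).complex.d (n+1) n ≫ f = 0) (v : Y ⟶ Y') :
    (NatTrans.leftDerived (NatTrans.rightOp ((linearYoneda R (ModuleCat.{0} R)).map v)) n).app X
        ≫ clsHom n f hf =
      clsHom n (f ≫ v) (by simp [reassoc_of% hf]) := by
  rw [clsHom, clsHom, ProjectiveResolution.leftDerived_app_eq _ (PR X)]
  simp only [Category.assoc, Iso.inv_hom_id_assoc]
  congr 1
  refine aux_nat ((NatTrans.mapHomologicalComplex (NatTrans.rightOp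
    ((linearYoneda R (ModuleCat.{0} R)).map v)) _).app (PR X).complex) n (toK f) _ _ _ ?_
  apply Quiver.Hom.unop_inj
  apply ModuleCat.hom_ext
  apply LinearMap.ext_ring
  change ((1 : R) • f) ≫ v = (1 : R) • (f ≫ v)
  simp

/-- scalar multiplication as an endomorphism of the identity functor -/
noncomputable def zc (r : R) : 𝟭 (ModuleCat.{0} R)ᵒᵖ ⟶ 𝟭 (ModuleCat.{0} R)ᵒᵖ where
  app X := (r • 𝟙 X.unop).op
  naturality X Y f := by
    apply Quiver.Hom.unop_inj
    simp

lemma Ext_smul (n : ℕ) (X Y : ModuleCat.{0} R) (r : R) :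
    ((Ext R (ModuleCat.{0} R) n).obj (Opposite.op X)).map (r • 𝟙 Y) = r • 𝟙 _ := by
  change ((NatTrans.leftDerived
    (NatTrans.rightOp ((linearYoneda R (ModuleCat.{0} R)).map (r • 𝟙 Y))) n).app X).unop = _
  apply Quiver.Hom.op_inj
  change _ = (zc r).app (((EF R Y).leftDerived n).obj X)
  rw [Quiver.Hom.op_unop, ProjectiveResolution.leftDerived_app_eq _ (PR X)]
  rw [HomologicalComplex.homologyFunctor_map]
  rw [aux_center (zc r)]
  · have := (zc r).naturality ((PR X).isoLeftDerivedObj (EF R Y) n).inv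
    erw [← this]
    simp
  · apply Quiver.Hom.unop_inj
    apply ModuleCat.hom_ext
    apply LinearMap.ext
    intro (x : (PR X).complex.X n ⟶ Y)
    change x ≫ (r • 𝟙 Y) = r • x
    simp
end
section powers
open RingTheory.Sequence Pointwise
variable {R : Type} [CommRing R]

lemma wr_ext (rs : List R) : ∀ {A B C : Type} [AddCommGroup A] [AddCommGroup B] [AddCommGroup C]
    [Module R A] [Module R B] [Module R C] (f : A →ₗ[R] B) (g : B →ₗ[R] C)
    (_ : Function.Injective f) (_ : Function.Exact f g) (_ : Function.Surjective g)
    (_ : IsWeaklyRegular A rs) (_ : IsWeaklyRegular C rs), IsWeaklyRegular B rs := by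
  induction rs with
  | nil => intros; exact IsWeaklyRegular.nil _ _
  | cons x rs ih =>
    intro A B C _ _ _ _ _ _ f g hf hfg hg hA hC
    rw [isWeaklyRegular_cons_iff] at hA hC ⊢
    refine ⟨isSMulRegular_of_range_eq_ker hf hfg.linearMap_ker_eq.symm hA.1 hC.1, ?_⟩
    refine ih (QuotSMulTop.map x f) (QuotSMulTop.map x g) ?_ (QuotSMulTop.map_exact x hfg hg)
      (QuotSMulTop.map_surjective x hg) hA.2 hC.2
    have h0 : Function.Exact (0 : A →ₗ[R] A) f := by
      intro y
      simp only [Set.mem_range, LinearMap.zero_apply, exists_const]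
      rw [map_eq_zero_iff f hf, eq_comm]
    have := QuotSMulTop.map_first_exact_on_four_term_exact_of_isSMulRegular_last h0 hfg hC.1
    rw [map_zero] at this
    rw [injective_iff_map_eq_zero]
    intro y hy
    obtain ⟨z, hz⟩ := (this y).1 hy
    simpa using hz.symm

lemma wr_subsingleton (rs : List R) : ∀ {M : Type} [AddCommGroup M] [Module R M]
    [Subsingleton M], IsWeaklyRegular M rs := by
  induction rs with
  | nil => intros; exact IsWeaklyRegular.nil _ _
  | cons x rs ih =>
    intro M _ _ _
    rw [isWeaklyRegular_cons_iff]
    exact ⟨fun _ _ _ => Subsingleton.elim _ _, ih⟩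

lemma wr_pow_one {M : Type} [AddCommGroup M] [Module R M] (x : R) (hx : IsSMulRegular M x)
    (rs : List R) (h : IsWeaklyRegular (QuotSMulTop x M) rs) (t : ℕ) :
    IsWeaklyRegular (QuotSMulTop (x ^ t) M) rs := by
  induction t with
  | zero =>
    have : Subsingleton (QuotSMulTop (x ^ 0) M) := by
      rw [Submodule.Quotient.subsingleton_iff]
      simp
    exact wr_subsingleton rs
  | succ t ih =>
    have memi : ∀ (s : R) (m : M), m ∈ s • (⊤ : Submodule R M) ↔ ∃ m', s • m' = m := by
      intro s m
      simp [Submodule.mem_smul_pointwise_iff_exists]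
    let f : QuotSMulTop (x ^ t) M →ₗ[R] QuotSMulTop (x ^ (t+1)) M :=
      Submodule.mapQ _ _ (LinearMap.lsmul R M x) (by
        intro m hm
        obtain ⟨m', rfl⟩ := (memi _ _).1 hm
        refine (memi _ _).2 ⟨m', ?_⟩
        simp [smul_smul, pow_succ', mul_comm])
    let g : QuotSMulTop (x ^ (t+1)) M →ₗ[R] QuotSMulTop x M :=
      Submodule.mapQ _ _ LinearMap.id (by
        intro m hm
        obtain ⟨m', rfl⟩ := (memi _ _).1 hm
        refine (memi _ _).2 ⟨x ^ t • m', ?_⟩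
        simp [smul_smul, pow_succ'])
    refine wr_ext rs f g ?_ ?_ ?_ ih h
    · rw [injective_iff_map_eq_zero]
      intro y hy
      obtain ⟨y, rfl⟩ := Submodule.Quotient.mk_surjective _ y
      obtain ⟨m', hm'⟩ := (memi _ _).1 ((Submodule.Quotient.mk_eq_zero _).1 hy)
      refine (Submodule.Quotient.mk_eq_zero _).2 ((memi _ _).2 ⟨m', ?_⟩)
      apply hx
      simpa [smul_smul, pow_succ'] using hm'
    · intro y
      obtain ⟨y, rfl⟩ := Submodule.Quotient.mk_surjective _ y
      constructor
      · intro hy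
        obtain ⟨m', hm'⟩ := (memi _ _).1 ((Submodule.Quotient.mk_eq_zero _).1 hy)
        refine ⟨Submodule.Quotient.mk m', ?_⟩
        simp only [f, Submodule.mapQ_apply]
        congr 1
      · rintro ⟨z, hz⟩
        obtain ⟨z, rfl⟩ := Submodule.Quotient.mk_surjective _ z
        rw [← hz]
        simp only [f, g, Submodule.mapQ_apply]
        refine (Submodule.Quotient.mk_eq_zero _).2 ((memi _ _).2 ⟨z, rfl⟩)
    · intro y
      obtain ⟨y, rfl⟩ := Submodule.Quotient.mk_surjective _ y
      exact ⟨Submodule.Quotient.mk y, rfl⟩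

lemma wr_pow (rs : List R) (t : ℕ) : ∀ {M : Type} [AddCommGroup M] [Module R M]
    (_ : IsWeaklyRegular M rs), IsWeaklyRegular M (rs.map (· ^ t)) := by
  induction rs with
  | nil => intros; exact IsWeaklyRegular.nil _ _
  | cons x rs ih =>
    intro M _ _ h
    rw [isWeaklyRegular_cons_iff] at h
    rw [List.map_cons, isWeaklyRegular_cons_iff]
    exact ⟨h.1.pow t, wr_pow_one x h.1 _ (ih h.2) t⟩

lemma ofList_pow_le (rs : List R) (t : ℕ) (ht : t ≠ 0) :
    Ideal.ofList (rs.map (· ^ t)) ≤ Ideal.ofList rs := by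
  rw [Ideal.ofList, Ideal.span_le]
  intro y hy
  obtain ⟨x, hx, rfl⟩ := List.mem_map.1 hy
  exact Ideal.pow_mem_of_mem (Ideal.ofList rs) (Ideal.subset_span (show x ∈ {r | r ∈ rs} from hx)) t (Nat.pos_of_ne_zero ht)

lemma ofList_pow_le_pow (rs : List R) (t : ℕ) :
    Ideal.ofList (rs.map (· ^ t)) ≤ Ideal.ofList rs ^ t := by
  rw [Ideal.ofList, Ideal.span_le]
  intro y hy
  obtain ⟨x, hx, rfl⟩ := List.mem_map.1 hy
  exact Ideal.pow_mem_pow (I := Ideal.ofList rs) (Ideal.subset_span (show x ∈ {r | r ∈ rs} from hx)) t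

lemma exists_pow_le_ofList (rs : List R) (t : ℕ) :
    ∃ s, Ideal.ofList rs ^ s ≤ Ideal.ofList (rs.map (· ^ t)) := by
  apply Ideal.exists_pow_le_of_le_radical_of_fg
  · rw [Ideal.ofList, Ideal.span_le]
    intro x hx
    exact ⟨t, Ideal.subset_span (List.mem_map.2 ⟨x, hx, rfl⟩)⟩
  · classical exact ⟨rs.toFinset, by simp [Ideal.ofList]⟩

lemma reg_pow (rs : List R) (t : ℕ) (ht : t ≠ 0) {M : Type} [AddCommGroup M] [Module R M]
    (h : IsRegular M rs) : IsRegular M (rs.map (· ^ t)) := by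
  refine ⟨wr_pow rs t h.1, fun h' => h.2 ?_⟩
  refine (top_le_iff.1 (h'.le.trans ?_)).symm
  exact Submodule.smul_mono_left (ofList_pow_le rs t ht)

end powers
section extpart
open RingTheory.Sequence Pointwise
open CategoryTheory.Abelian
variable {R : Type} [CommRing R]

lemma mem_cons_smul {M : Type} [AddCommGroup M] [Module R M] (x : R) (rs : List R) (m : M) :
    (Submodule.Quotient.mk m : QuotSMulTop x M) ∈ Ideal.ofList rs • (⊤ : Submodule R _) ↔
      m ∈ Ideal.ofList (x :: rs) • (⊤ : Submodule R M) := by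
  rw [Ideal.ofList_cons_smul, sup_comm]
  have := Submodule.comap_smul_top_of_surjective (Ideal.ofList rs)
    (Submodule.mkQ (x • (⊤ : Submodule R M))) (Submodule.mkQ_surjective _)
  rw [Submodule.ker_mkQ] at this
  rw [← this]
  rfl

lemma supp_quot (J : Ideal R) : Module.support R (R ⧸ J) ⊆ PrimeSpectrum.zeroLocus J := by
  rw [Module.support_eq_zeroLocus, Ideal.annihilator_quotient]

lemma ext_kill [IsNoetherianRing R] (J : Ideal R) (r : R) (rs : List R) (hmem : ∀ x ∈ rs, x ∈ J) :
    ∀ (M : ModuleCat.{0} R) [Module.Finite R M] (_ : IsRegular M rs)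
      (_ : ∀ j ∈ J, ∀ m : M, j • m ∈ Ideal.ofList rs • (⊤ : Submodule R M))
      (_ : ∀ e : Abelian.Ext.{0} (ModuleCat.of R (R ⧸ J)) M rs.length, r • e = 0) (m : M),
      r • m ∈ Ideal.ofList rs • (⊤ : Submodule R M) := by
  induction rs with
  | nil =>
    intro M _ hreg hJ hr m
    simp only [Ideal.ofList_nil, Submodule.bot_smul, Submodule.mem_bot] at hJ ⊢
    let φ : (R ⧸ J) →ₗ[R] M := Submodule.liftQ J (LinearMap.toSpanSingleton R M m) (by
      intro j hj
      exact LinearMap.mem_ker.2 ((LinearMap.toSpanSingleton_apply R M m j).trans (hJ j hj m)))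
    have h := hr (Abelian.Ext.mk₀ (ModuleCat.ofHom φ))
    rw [← Abelian.Ext.mk₀_smul, Abelian.Ext.mk₀_eq_zero_iff] at h
    have h2 := congrArg (fun q => q.hom (Submodule.Quotient.mk (1 : R) : R ⧸ J)) h
    have h3 : φ (Submodule.Quotient.mk (1 : R) : R ⧸ J) = m := by
      simp only [φ]
      erw [Submodule.liftQ_apply]
      simp
    rw [← h3]
    exact h2
  | cons x rs ih =>
    intro M _ hreg hJ hr m
    have hlt : J • (⊤ : Submodule R M) < ⊤ := by
      refine lt_of_le_of_lt ?_ hreg.2.symm.lt_top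
      rw [Submodule.smul_le]
      intro j hj m _
      exact hJ j hj m
    have hvan := ModuleCat.subsingleton_ext_of_exists_isRegular J (ModuleCat.of R (R ⧸ J))
      (supp_quot J) M hlt (x :: rs) hmem hreg
    rw [isRegular_cons_iff] at hreg
    rw [← mem_cons_smul]
    refine ih (fun y hy => hmem y (List.mem_cons_of_mem _ hy)) (ModuleCat.of R (QuotSMulTop x M))
      hreg.2 ?_ ?_ (Submodule.Quotient.mk m)
    · intro j hj y
      obtain ⟨y, rfl⟩ := Submodule.Quotient.mk_surjective _ y
      exact (mem_cons_smul x rs (j • y)).2 (hJ j hj y)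
    · intro e
      have hS := hreg.1.smulShortComplex_shortExact (M := M)
      have h0 := hr (e.comp hS.extClass rfl)
      have h : (r • e).comp hS.extClass rfl = 0 :=
        (Abelian.Ext.smul_comp e hS.extClass rfl r).trans h0
      obtain ⟨e', he'⟩ := Abelian.Ext.covariant_sequence_exact₃ _ hS (r • e) rfl h
      have : Subsingleton (Abelian.Ext.{0} (ModuleCat.of R (R ⧸ J))
          (M.smulShortComplex x).X₂ rs.length) := hvan rs.length (by simp)
      rw [← he', Subsingleton.elim e' 0, Abelian.Ext.zero_comp]
      rfl

lemma precomp_inj [IsNoetherianRing R] (a : Ideal R) (M : ModuleCat.{0} R) [Module.Finite R M]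
    (rs : List R) (hreg : IsRegular M rs) (ha : Ideal.ofList rs = a)
    {X Z : ModuleCat.{0} R} [Module.Finite R X] (u : X ⟶ Z) [Epi u]
    (hX : Module.support R X ⊆ PrimeSpectrum.zeroLocus a)
    (e : Abelian.Ext.{0} Z M rs.length)
    (he : (Abelian.Ext.mk₀ u).comp e (zero_add _) = 0) : e = 0 := by
  rcases Nat.eq_zero_or_pos rs.length with h0 | hpos
  · generalize rs.length = n at *
    subst h0
    apply Abelian.Ext.precomp_mk₀_injective_of_epi M u
    simpa using he
  · let S := ShortComplex.mk (kernel.ι u) u (by simp)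
    have hS : S.ShortExact :=
      { exact := ShortComplex.exact_of_f_is_kernel _ (kernelIsKernel u) }
    obtain ⟨e', he'⟩ := Abelian.Ext.contravariant_sequence_exact₃ hS M e he
      (n₀ := rs.length - 1) (by omega)
    have hinj : Function.Injective (kernel.ι u).hom :=
      (ModuleCat.mono_iff_injective (kernel.ι u)).1 inferInstance
    have : Module.Finite R (kernel u : ModuleCat.{0} R) := Module.Finite.of_injective _ hinj
    have hs := Module.support_subset_of_injective _ hinj
    have hlt : a • (⊤ : Submodule R M) < ⊤ := ha ▸ hreg.2.symm.lt_top
    have := ModuleCat.subsingleton_ext_of_exists_isRegular a (kernel u)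
      (hs.trans hX) M hlt rs (fun x hx => ha ▸ Ideal.subset_span hx) hreg (rs.length - 1) (by omega)
    rw [← he', Subsingleton.elim e' 0, Abelian.Ext.comp_zero]
end extpart

section oldnew
variable {R : Type} [CommRing R]

/-- the class of a cocycle in the derived functor `Ext`. -/
noncomputable def cls {X Y : ModuleCat.{0} R} (n : ℕ) (f : (PR X).complex.X n ⟶ Y)
    (hf : (PR X).complex.d (n+1) n ≫ f = 0) :
    ((Ext R (ModuleCat.{0} R) n).obj (Opposite.op X)).obj Y :=
  (clsHom n f hf).unop.hom (1 : R)

lemma cls_smul {X Y : ModuleCat.{0} R} (n : ℕ) (f : (PR X).complex.X n ⟶ Y)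
    (hf : (PR X).complex.d (n+1) n ≫ f = 0) (r : R) :
    r • cls n f hf = cls n (f ≫ (r • 𝟙 Y)) (by rw [reassoc_of% hf, zero_comp]) := by
  have h1 := clsHom_natY n f hf (r • 𝟙 Y)
  have h2 := congrArg (fun k => k.unop.hom (1 : R)) h1
  refine Eq.trans ?_ h2
  have h3 := Ext_smul n X Y r
  have h4 := congrArg (fun k => k.hom (cls n f hf)) h3
  exact h4.symm

lemma cls_map {X X' Y : ModuleCat.{0} R} (n : ℕ) (f : (PR X).complex.X n ⟶ Y)
    (hf : (PR X).complex.d (n+1) n ≫ f = 0) (u : X' ⟶ X)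
    (φ : ProjectiveResolution.Hom (PR X') (PR X) u) :
    (((Ext R (ModuleCat.{0} R) n).map u.op).app Y).hom (cls n f hf) =
      cls n (φ.hom.f n ≫ f) (by simp [← φ.hom.comm_assoc, hf]) :=
  congrArg (fun k => k.unop.hom (1 : R)) (clsHom_nat n f hf u φ)

lemma cls_vanish {X Y : ModuleCat.{0} R} (n : ℕ) (f : (PR X).complex.X n ⟶ Y)
    (hf : (PR X).complex.d (n+1) n ≫ f = 0) (h : cls n f hf = 0) :
    (PR X).extMk f (n+1) rfl hf = 0 := by
  have h0 : clsHom n f hf = 0 := by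
    apply Quiver.Hom.unop_inj
    apply ModuleCat.hom_ext
    apply LinearMap.ext_ring
    exact h
  rcases clsHom_vanish n f hf h0 with ⟨_, h1⟩ | ⟨p, hp, g, hg⟩
  · subst h1
    exact (PR X).extMk_zero (n+1) rfl
  · exact ((PR X).extMk_eq_zero_iff f (n+1) rfl hf p hp).2 ⟨g, hg⟩

lemma old_new {X X' Y : ModuleCat.{0} R} (n : ℕ) (f : (PR X).complex.X n ⟶ Y)
    (hf : (PR X).complex.d (n+1) n ≫ f = 0) (u : X' ⟶ X) (r : R)
    (h : (((Ext R (ModuleCat.{0} R) n).map u.op).app Y).hom (r • cls n f hf) = 0) :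
    r • (Abelian.Ext.mk₀ u).comp ((PR X).extMk f (n+1) rfl hf) (zero_add n) = 0 := by
  let φ : ProjectiveResolution.Hom (PR X') (PR X) u :=
    { hom := ProjectiveResolution.lift u (PR X') (PR X)
      hom_f_zero_comp_π_f_zero := by
        have := ProjectiveResolution.lift_commutes_zero u (PR X') (PR X)
        exact this }
  have hf' : (PR X).complex.d (n+1) n ≫ f ≫ (r • 𝟙 Y) = 0 := by
    rw [reassoc_of% hf, zero_comp]
  rw [cls_smul, cls_map n (f ≫ (r • 𝟙 Y)) hf' u φ] at h
  have h1 := cls_vanish _ _ _ h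
  rw [← Abelian.Ext.comp_smul, Abelian.Ext.smul_eq_comp_mk₀,
    ProjectiveResolution.extMk_comp_mk₀, ProjectiveResolution.mk₀_comp_extMk _ _ _ _ φ]
  exact h1

end oldnew

section lc
variable {R : Type} [CommRing R]
open localCohomology

/-- the colimit cocone computing local cohomology of a module. -/
noncomputable def lcCocone (a : Ideal R) (n : ℕ) (M : ModuleCat.{0} R) :
    Cocone (diagram (idealPowersDiagram a) n ⋙ (evaluation _ _).obj M) :=
  ((evaluation _ _).obj M).mapCocone (colimit.cocone (diagram (idealPowersDiagram a) n))

noncomputable def lcIsColimit (a : Ideal R) (n : ℕ) (M : ModuleCat.{0} R) :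
    IsColimit (lcCocone a n M) :=
  isColimitOfPreserves _ (colimit.isColimit _)

lemma smul_comp_aux {A B : ModuleCat.{0} R} (k : A ⟶ B) (r : R) :
    (r • 𝟙 A) ≫ k = k ≫ (r • 𝟙 B) := by simp

lemma lc_smul (a : Ideal R) (n : ℕ) (M : ModuleCat.{0} R) (r : R) :
    (localCohomology a n).map (r • 𝟙 M) = r • 𝟙 ((localCohomology a n).obj M) := by
  apply (lcIsColimit a n M).hom_ext
  intro j
  have h1 := (colimit.ι (diagram (idealPowersDiagram a) n) j).naturality (r • 𝟙 M)
  refine h1.symm.trans ?_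
  have h2 := Ext_smul n ((ringModIdeals (idealPowersDiagram a)).obj j.unop) M r
  refine (congrArg (fun q => q ≫ _) h2).trans ?_
  exact smul_comp_aux ((lcCocone a n M).ι.app j) r

lemma lc_kill (a : Ideal R) (n : ℕ) (M : ModuleCat.{0} R) (r : R)
    (hr : r ∈ Module.annihilator R ((localCohomology a n).obj M)) (s : ℕ)
    (x : ((Ext R (ModuleCat.{0} R) n).obj
      (Opposite.op (ModuleCat.of R (R ⧸ a ^ s)))).obj M) :
    ∃ (s' : ℕ) (h : a ^ s' ≤ a ^ s), (((Ext R (ModuleCat.{0} R) n).map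
      (ModuleCat.ofHom (Submodule.mapQ (a ^ s') (a ^ s) LinearMap.id h) :
        ModuleCat.of R (R ⧸ a ^ s') ⟶ ModuleCat.of R (R ⧸ a ^ s)).op).app M).hom (r • x) = 0 := by
  let j : ℕᵒᵖᵒᵖ := Opposite.op (Opposite.op s)
  have h0 : ((lcCocone a n M).ι.app j).hom (r • x) =
      ((lcCocone a n M).ι.app j).hom 0 := by
    refine ((((lcCocone a n M).ι.app j).hom).map_smul r x).trans ?_
    exact (Module.mem_annihilator.1 hr _).trans (map_zero ((lcCocone a n M).ι.app j).hom).symm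
  obtain ⟨k, f, g, hfg⟩ := Concrete.isColimit_exists_of_rep_eq _ (lcIsColimit a n M) _ _ h0
  refine ⟨k.unop.unop, Ideal.pow_le_pow_right f.unop.unop.down.down, ?_⟩
  exact hfg.trans (map_zero _)
end lc

section final
open RingTheory.Sequence
variable {R : Type} [CommRing R]

lemma ann_le [IsNoetherianRing R] [IsLocalRing R] (a : Ideal R) (M : ModuleCat.{0} R)
    [Module.Finite R M] (rs : List R) (hreg : IsRegular M rs) (ha : Ideal.ofList rs = a)
    (r : R) (hr : r ∈ Module.annihilator R ((localCohomology a rs.length).obj M)) :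
    r ∈ Module.annihilator R M := by
  have hlt : a • (⊤ : Submodule R M) < ⊤ := ha ▸ hreg.2.symm.lt_top
  have hne : a ≠ ⊤ := by
    rintro rfl
    simp at hlt
  have key : ∀ t : ℕ, t ≠ 0 → ∀ m : M, r • m ∈ a ^ t • (⊤ : Submodule R M) := by
    intro t ht m
    have hreg' := reg_pow rs t ht hreg
    let J := Ideal.ofList (rs.map (· ^ t))
    refine Submodule.smul_mono_left (ha ▸ ofList_pow_le_pow rs t : J ≤ a ^ t) ?_
    refine ext_kill J r (rs.map (· ^ t)) (fun x hx => Ideal.subset_span hx) M hreg' ?_ ?_ m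
    · intro j hj m
      exact Submodule.smul_mem_smul hj trivial
    obtain ⟨s, hs⟩ := exists_pow_le_ofList rs t
    rw [ha] at hs
    rw [List.length_map]
    intro e
    have hsupp : ∀ s : ℕ, Module.support R (R ⧸ a ^ s) ⊆ PrimeSpectrum.zeroLocus a := by
      intro s
      refine (supp_quot (a ^ s)).trans ?_
      intro p hp x hx
      exact p.2.mem_of_pow_mem s (hp (Ideal.pow_mem_pow hx s))
    have hepi : ∀ (I I' : Ideal R) (h : I ≤ I'), Epi (ModuleCat.ofHom
        (Submodule.mapQ I I' LinearMap.id h) : ModuleCat.of R (R ⧸ I) ⟶ ModuleCat.of R (R ⧸ I')) := by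
      intro I I' h
      rw [ModuleCat.epi_iff_surjective]
      intro y
      obtain ⟨y, rfl⟩ := Submodule.Quotient.mk_surjective _ y
      exact ⟨Submodule.Quotient.mk y, rfl⟩
    let v : ModuleCat.of R (R ⧸ a ^ s) ⟶ ModuleCat.of R (R ⧸ J) :=
      ModuleCat.ofHom (Submodule.mapQ (a ^ s) J LinearMap.id hs)
    have := hepi _ _ hs
    refine precomp_inj a M rs hreg ha v (hsupp s) (r • e) ?_
    rw [Abelian.Ext.comp_smul]
    obtain ⟨f, hf, hfe⟩ := (PR (ModuleCat.of R (R ⧸ a ^ s))).extMk_surjective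
      ((Abelian.Ext.mk₀ v).comp e (zero_add _)) (rs.length + 1) rfl
    obtain ⟨s', hs', hx⟩ := lc_kill a rs.length M r hr s (cls rs.length f hf)
    have := hepi _ _ hs'
    refine precomp_inj a M rs hreg ha (ModuleCat.ofHom (Submodule.mapQ (a ^ s') (a ^ s)
      LinearMap.id hs')) (hsupp s') _ ?_
    rw [Abelian.Ext.comp_smul, ← hfe]
    exact old_new _ f hf _ r hx
  rw [Module.mem_annihilator]
  intro m
  have hK := Ideal.iInf_pow_smul_eq_bot_of_isLocalRing (M := M) a hne
  have : r • m ∈ (⨅ i : ℕ, a ^ i • (⊤ : Submodule R M)) := by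
    rw [Submodule.mem_iInf]
    intro i
    rcases Nat.eq_zero_or_pos i with rfl | hi
    · simp
    · exact key i hi.ne' m
  rw [hK] at this
  exact (Submodule.mem_bot R).1 this

end final

theorem stmt10 {R : Type} [CommRing R] [IsNoetherianRing R] [IsLocalRing R]
    (a : Ideal R) (M : ModuleCat R) [Module.Finite R M] (hM : Nontrivial M)
    (n : ℕ) (rs : List R) (hlen : rs.length = n)
    (hreg : RingTheory.Sequence.IsRegular M rs)
    (hgen : Ideal.span {r | r ∈ rs} = a)
    (T : Submodule R M)
    (hT : IsGreatest {N : Submodule R M |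
      ∀ i, n ≤ i → Subsingleton ((localCohomology a i).obj (ModuleCat.of R N))} T) :
    Module.annihilator R ((localCohomology a n).obj M) =
        Module.annihilator R (M ⧸ T) ∧
      Module.annihilator R (M ⧸ T) = Module.annihilator R M := by
  subst hlen
  have h1 : Module.annihilator R ((localCohomology a rs.length).obj M) ≤
      Module.annihilator R M := fun r hr => ann_le a M rs hreg hgen r hr
  have h2 : Module.annihilator R M ≤ Module.annihilator R (M ⧸ T) :=
    LinearMap.annihilator_le_of_surjective T.mkQ T.mkQ_surjective
  have h3 : Module.annihilator R (M ⧸ T) ≤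
      Module.annihilator R ((localCohomology a rs.length).obj M) := by
    intro r hr
    have hsub := hT.1 rs.length le_rfl
    have hmem : ∀ m : M, r • m ∈ T := fun m =>
      (Submodule.Quotient.mk_eq_zero T).1
        (Module.mem_annihilator.1 hr (Submodule.Quotient.mk m))
    let p : M ⟶ ModuleCat.of R T :=
      ModuleCat.ofHom (LinearMap.codRestrict T (LinearMap.lsmul R M r) hmem)
    let q : ModuleCat.of R T ⟶ M := ModuleCat.ofHom T.subtype
    have hpq : p ≫ q = r • 𝟙 M := by
      ext m
      rfl
    rw [Module.mem_annihilator]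
    intro x
    have h := lc_smul a rs.length M r
    rw [← hpq, Functor.map_comp] at h
    have hx := congrArg (fun k => k.hom x) h
    refine Eq.trans hx.symm ?_
    have h0 : ((localCohomology a rs.length).map p).hom x = 0 := Subsingleton.elim _ _
    exact (congrArg ((localCohomology a rs.length).map q).hom h0).trans (map_zero _)
  exact ⟨le_antisymm (h1.trans h2) h3, le_antisymm (h3.trans h1) h2⟩
end

section
/- Let R be a Noetherian ring, 𝔞 an ideal, and M a relative Cohen-Macaulay R-module with respect to 𝔞 with cd(𝔞, M) = c. Then Supp(H^c_𝔞(M)) = Supp(M) ∩ V(𝔞). -/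
open CategoryTheory

namespace RCM
open Limits Opposite
open scoped Pointwise

variable {R : Type} [CommRing R]

noncomputable abbrev yF (Y : ModuleCat.{0} R) : ModuleCat.{0} R ⥤ (ModuleCat.{0} R)ᵒᵖ :=
  ((linearYoneda R (ModuleCat.{0} R)).obj Y).rightOp

noncomputable abbrev yK {X : ModuleCat.{0} R} (P : ProjectiveResolution X) (Y : ModuleCat.{0} R) :
    ChainComplex (ModuleCat.{0} R)ᵒᵖ ℕ :=
  ((yF Y).mapHomologicalComplex (ComplexShape.down ℕ)).obj P.complex

/-- the module of cocycles -/
noncomputable abbrev Z {X : ModuleCat.{0} R} (P : ProjectiveResolution X) (Y : ModuleCat.{0} R) (n : ℕ) :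
    ModuleCat.{0} R := ((yK P Y).opcycles n).unop

/-- underlying cochain -/
noncomputable def zi {X : ModuleCat.{0} R} (P : ProjectiveResolution X) (Y : ModuleCat.{0} R) (n : ℕ) :
    Z P Y n ⟶ ModuleCat.of R (P.complex.X n ⟶ Y) := ((yK P Y).pOpcycles n).unop

/-- the derived functor computed by a resolution -/
noncomputable def lI {X : ModuleCat.{0} R} (P : ProjectiveResolution X) (Y : ModuleCat.{0} R) (n : ℕ) :
    ((yF Y).leftDerived n).obj X ≅ (yK P Y).homology n := P.isoLeftDerivedObj (yF Y) n

lemma lI_nat {X X' : ModuleCat.{0} R} (P : ProjectiveResolution X) (P' : ProjectiveResolution X')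
   (Y : ModuleCat.{0} R) (n : ℕ) (g : X' ⟶ X) (φ : ProjectiveResolution.Hom P' P g) :
   ((yF Y).leftDerived n).map g ≫ (lI P Y n).hom = (lI P' Y n).hom ≫
     HomologicalComplex.homologyMap
       (((yF Y).mapHomologicalComplex (ComplexShape.down ℕ)).map φ.hom) n :=
  ProjectiveResolution.isoLeftDerivedObj_hom_naturality g P' P φ.hom
      φ.hom_f_zero_comp_π_f_zero (yF Y) n

/-- class in Ext -/
noncomputable def zq {X : ModuleCat.{0} R} (P : ProjectiveResolution X) (Y : ModuleCat.{0} R) (n : ℕ) :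
    Z P Y n ⟶ ((Ext R (ModuleCat.{0} R) n).obj (op X)).obj Y :=
  ((lI P Y n).hom ≫ (yK P Y).homologyι n).unop

lemma zq_surj {X : ModuleCat.{0} R} (P : ProjectiveResolution X) (Y : ModuleCat.{0} R) (n : ℕ) :
    Function.Surjective (zq P Y n) := by
  rw [← ModuleCat.epi_iff_surjective]
  exact unop_epi_of_mono ((lI P Y n).hom ≫ (yK P Y).homologyι n)

lemma zi_inj {X : ModuleCat.{0} R} (P : ProjectiveResolution X) (Y : ModuleCat.{0} R) (n : ℕ) :
    Function.Injective (zi P Y n) := by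
  rw [← ModuleCat.mono_iff_injective]
  exact unop_mono_of_epi ((yK P Y).pOpcycles n)

/-- zero class, positive degree -/
lemma zq_eq_zero_succ {X : ModuleCat.{0} R} (P : ProjectiveResolution X) (Y : ModuleCat.{0} R)
    (n : ℕ) (z : Z P Y (n+1)) (hz : zq P Y (n+1) z = 0) :
    ∃ g : P.complex.X n ⟶ Y, P.complex.d (n+1) n ≫ g = zi P Y (n+1) z := by
  have h1 := ShortComplex.exact_of_f_is_kernel (ShortComplex.mk ((yK P Y).homologyι (n+1)) ((yK P Y).fromOpcycles (n+1) n) (by simp))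
    ((yK P Y).homologyIsKernel (n+1) n (by simp))
  have h2 := h1.unop
  rw [ShortComplex.moduleCat_exact_iff] at h2
  have hz' : (((yK P Y).homologyι (n+1)).unop) z = 0 := by
    have : Mono ((lI P Y (n+1)).hom.unop) := inferInstance
    rw [ModuleCat.mono_iff_injective] at this
    apply this
    rw [map_zero]
    exact hz
  obtain ⟨g, hg⟩ := h2 z hz'
  refine ⟨g, ?_⟩
  have h3 := (yK P Y).p_fromOpcycles (n+1) n
  have h4 := congrArg Quiver.Hom.unop h3
  rw [← hg]
  exact (ConcreteCategory.congr_hom h4 g).symm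

lemma zq_eq_zero_zero {X : ModuleCat.{0} R} (P : ProjectiveResolution X) (Y : ModuleCat.{0} R)
    (z : Z P Y 0) (hz : zq P Y 0 z = 0) : z = 0 := by
  have hi : IsIso ((yK P Y).homologyι 0) :=
    (yK P Y).isIso_homologyι 0 0 (by simp) (by simp)
  have : Mono (zq P Y 0) := unop_mono_of_epi ((lI P Y 0).hom ≫ (yK P Y).homologyι 0)
  rw [ModuleCat.mono_iff_injective] at this
  apply this
  rw [hz, map_zero]

lemma zi_cocycle {X : ModuleCat.{0} R} (P : ProjectiveResolution X) (Y : ModuleCat.{0} R) (n : ℕ)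
    (z : Z P Y n) : P.complex.d (n+1) n ≫ (show P.complex.X n ⟶ Y from zi P Y n z) = 0 := by
  have h3 := (yK P Y).d_pOpcycles (n+1) n
  exact ConcreteCategory.congr_hom (congrArg Quiver.Hom.unop h3) z

lemma exists_zi {X : ModuleCat.{0} R} (P : ProjectiveResolution X) (Y : ModuleCat.{0} R) (n : ℕ)
    (f : P.complex.X n ⟶ Y) (hf : P.complex.d (n+1) n ≫ f = 0) : ∃ z : Z P Y n, zi P Y n z = f := by
  let k : (yK P Y).X n ⟶ op (ModuleCat.of R R) :=
    (ModuleCat.ofHom (LinearMap.toSpanSingleton R (P.complex.X n ⟶ Y) f)).op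
  have hk : (yK P Y).d (n+1) n ≫ k = 0 := by
    apply Quiver.Hom.unop_inj
    apply ModuleCat.hom_ext
    apply LinearMap.ext_ring
    have : P.complex.d (n+1) n ≫ ((1:R) • f) = 0 := by rw [one_smul]; exact hf
    exact this
  refine ⟨((yK P Y).descOpcycles k (n+1) (by simp) hk).unop (1 : R), ?_⟩
  have h := (yK P Y).p_descOpcycles k (n+1) (by simp) hk
  refine (ConcreteCategory.congr_hom (congrArg Quiver.Hom.unop h) (1:R)).trans ?_
  exact one_smul R f

lemma zq_nat {X X' : ModuleCat.{0} R} (P : ProjectiveResolution X) (P' : ProjectiveResolution X')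
   (Y : ModuleCat.{0} R) (n : ℕ) (g : X' ⟶ X) (φ : ProjectiveResolution.Hom P' P g) (z : Z P Y n) :
   ∃ z' : Z P' Y n, (zi P' Y n z' : P'.complex.X n ⟶ Y) = φ.hom.f n ≫ (zi P Y n z : P.complex.X n ⟶ Y) ∧
    (((Ext R (ModuleCat.{0} R) n).map g.op).app Y) (zq P Y n z) = zq P' Y n z' := by
  refine ⟨(HomologicalComplex.opcyclesMap (((yF Y).mapHomologicalComplex (ComplexShape.down ℕ)).map φ.hom) n).unop z, ?_, ?_⟩
  · have h := HomologicalComplex.p_opcyclesMap (((yF Y).mapHomologicalComplex (ComplexShape.down ℕ)).map φ.hom) n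
    exact (ConcreteCategory.congr_hom (congrArg Quiver.Hom.unop h) z)
  · have h := lI_nat P P' Y n g φ
    have h2 := HomologicalComplex.homologyι_naturality (((yF Y).mapHomologicalComplex (ComplexShape.down ℕ)).map φ.hom) n
    have h3 : ((yF Y).leftDerived n).map g ≫ (lI P Y n).hom ≫ (yK P Y).homologyι n =
      ((lI P' Y n).hom ≫ (yK P' Y).homologyι n) ≫ HomologicalComplex.opcyclesMap (((yF Y).mapHomologicalComplex (ComplexShape.down ℕ)).map φ.hom) n := by
      rw [← Category.assoc, h, Category.assoc, Category.assoc, ← h2]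
    exact (ConcreteCategory.congr_hom (congrArg Quiver.Hom.unop h3) z)

/-- element dies at p -/
def Dies (p : Ideal R) {A : Type} [AddCommGroup A] [Module R A] (x : A) : Prop :=
  ∃ s : R, s ∉ p ∧ s • x = 0

def Van (p : Ideal R) (N M : ModuleCat.{0} R) (i : ℕ) : Prop :=
  ∀ x : Abelian.Ext.{0} N M i, Dies p x

lemma smul_mk0_comp {X Y Z : ModuleCat.{0} R} {n : ℕ} (f : X ⟶ Y) (x : Abelian.Ext.{0} Y Z n) (s : R) :
    (Abelian.Ext.mk₀ f).comp (s • x) (zero_add n) = s • (Abelian.Ext.mk₀ f).comp x (zero_add n) := by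
  simp

lemma van_mid {p : Ideal R} [p.IsPrime] {S : ShortComplex (ModuleCat.{0} R)} (hS : S.ShortExact)
    (M : ModuleCat.{0} R) (i : ℕ) (h1 : Van p S.X₁ M i) (h3 : Van p S.X₃ M i) : Van p S.X₂ M i := by
  intro x
  obtain ⟨s, hs, h⟩ := h1 ((Abelian.Ext.mk₀ S.f).comp x (zero_add i))
  obtain ⟨y, hy⟩ := Abelian.Ext.contravariant_sequence_exact₂ hS M (s • x) (by simpa using h)
  obtain ⟨t, ht, h'⟩ := h3 y
  refine ⟨t * s, fun hts => (Ideal.IsPrime.mem_or_mem ‹_› hts).elim ht hs, ?_⟩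
  rw [mul_smul, ← hy, ← smul_mk0_comp, h']
  simp

lemma van_inj {p : Ideal R} [p.IsPrime] {S : ShortComplex (ModuleCat.{0} R)} (hS : S.ShortExact)
    (M : ModuleCat.{0} R) (i : ℕ) (h1 : ∀ j < i, Van p S.X₁ M j) (x : Abelian.Ext.{0} S.X₃ M i)
    (hx : Dies p ((Abelian.Ext.mk₀ S.g).comp x (zero_add i))) : Dies p x := by
  obtain ⟨s, hs, h⟩ := hx
  rw [← smul_mk0_comp] at h
  cases i with
  | zero =>
    have := hS.epi_g
    refine ⟨s, hs, Abelian.Ext.precomp_mk₀_injective_of_epi M S.g ?_⟩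
    simpa using h
  | succ i =>
    obtain ⟨y, hy⟩ := Abelian.Ext.contravariant_sequence_exact₃ hS M (s • x) h (add_comm 1 i)
    obtain ⟨t, ht, h'⟩ := h1 i (by lia) y
    refine ⟨t * s, fun hts => (Ideal.IsPrime.mem_or_mem ‹_› hts).elim ht hs, ?_⟩
    rw [mul_smul, ← hy, ← Abelian.Ext.comp_smul, h']
    simp

lemma van_cov {p : Ideal R} [p.IsPrime] {S : ShortComplex (ModuleCat.{0} R)} (hS : S.ShortExact)
    (N : ModuleCat.{0} R) (h1 : ∀ i, Van p N S.X₁ i) (h2 : ∀ i, Van p N S.X₂ i) (i : ℕ) :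
    Van p N S.X₃ i := by
  intro x
  obtain ⟨s, hs, h⟩ := h1 _ (x.comp hS.extClass rfl)
  obtain ⟨y, hy⟩ := Abelian.Ext.covariant_sequence_exact₃ N hS (s • x) rfl (by simpa using h)
  obtain ⟨t, ht, h'⟩ := h2 _ y
  refine ⟨t * s, fun hts => (Ideal.IsPrime.mem_or_mem ‹_› hts).elim ht hs, ?_⟩
  rw [mul_smul, ← hy, ← Abelian.Ext.smul_comp, h']
  simp

lemma van_kill {p : Ideal R} (N M : ModuleCat.{0} R) (s : R) (hs : s ∉ p) (h : ∀ m : M, s • m = 0)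
    (i : ℕ) : Van p N M i := by
  intro x
  refine ⟨s, hs, ?_⟩
  have : s • 𝟙 M = 0 := by ext m; exact h m
  rw [Abelian.Ext.smul_eq_comp_mk₀, this]
  simp

lemma van_kill' {p : Ideal R} (N M : ModuleCat.{0} R) (s : R) (hs : s ∉ p) (h : ∀ m : N, s • m = 0)
    (i : ℕ) : Van p N M i := by
  intro x
  refine ⟨s, hs, ?_⟩
  have : s • 𝟙 N = 0 := by ext m; exact h m
  have h2 : (Abelian.Ext.mk₀ (s • 𝟙 N)).comp x (zero_add i) = s • x := by
    rw [Abelian.Ext.mk₀_smul, Abelian.Ext.smul_comp]; simp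
  rw [← h2, this]; simp

lemma shortExact_mk {A B C : Type} [AddCommGroup A] [AddCommGroup B] [AddCommGroup C]
    [Module R A] [Module R B] [Module R C] (f : A →ₗ[R] B) (g : B →ₗ[R] C)
    (hf : Function.Injective f) (hg : Function.Surjective g) (h : Function.Exact f g) :
    (ShortComplex.mk (ModuleCat.ofHom f) (ModuleCat.ofHom g)
      (by ext x; exact h.apply_apply_eq_zero x)).ShortExact where
  exact := by
    rw [ShortComplex.moduleCat_exact_iff]
    exact fun x hx => (h x).1 hx
  mono_f := (ModuleCat.mono_iff_injective _).2 hf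
  epi_g := (ModuleCat.epi_iff_surjective _).2 hg

lemma van_iso {p : Ideal R} {N N' M : ModuleCat.{0} R} (e : N ≅ N') {i : ℕ} (h : Van p N M i) :
    Van p N' M i := by
  intro x
  obtain ⟨s, hs, h⟩ := h ((Abelian.Ext.mk₀ e.hom).comp x (zero_add i))
  refine ⟨s, hs, ?_⟩
  have := congrArg (fun t => (Abelian.Ext.mk₀ e.inv).comp t (zero_add i)) h
  simpa using this

lemma van_iso2 {p : Ideal R} {N M M' : ModuleCat.{0} R} (e : M ≅ M') {i : ℕ} (h : Van p N M i) :
    Van p N M' i := by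
  intro x
  obtain ⟨s, hs, h⟩ := h (x.comp (Abelian.Ext.mk₀ e.inv) (add_zero i))
  refine ⟨s, hs, ?_⟩
  have := congrArg (fun t => Abelian.Ext.comp t (Abelian.Ext.mk₀ e.hom) (add_zero i)) h
  simpa using this

/-- the p-torsion submodule -/
def ptor (p : Ideal R) [p.IsPrime] (M : Type) [AddCommGroup M] [Module R M] : Submodule R M where
  carrier := {x | Dies p x}
  zero_mem' := ⟨1, (Ideal.ne_top_iff_one p).1 (Ideal.IsPrime.ne_top ‹_›), by simp⟩
  add_mem' := by
    rintro x y ⟨s, hs, h⟩ ⟨t, ht, h'⟩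
    refine ⟨s * t, fun hts => (Ideal.IsPrime.mem_or_mem ‹_› hts).elim hs ht, ?_⟩
    rw [smul_add, mul_comm, mul_smul, h, mul_comm, mul_smul, h']; simp
  smul_mem' := by
    rintro c x ⟨s, hs, h⟩
    exact ⟨s, hs, by rw [smul_comm, h, smul_zero]⟩

lemma fg_kill (p : Ideal R) [p.IsPrime] {M : Type} [AddCommGroup M] [Module R M]
    (K : Submodule R M) (hK : K.FG) (h : ∀ x ∈ K, Dies p x) : ∃ s ∉ p, ∀ x ∈ K, s • x = 0 := by
  induction K, hK using Submodule.fg_induction with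
  | singleton x =>
    obtain ⟨s, hs, h⟩ := h x (Submodule.mem_span_singleton_self x)
    refine ⟨s, hs, fun y hy => ?_⟩
    obtain ⟨c, rfl⟩ := Submodule.mem_span_singleton.1 hy
    rw [smul_comm, h, smul_zero]
  | sup A B hA hB hA' hB' =>
    obtain ⟨s, hs, h1⟩ := hA' (fun x hx => h x (Submodule.mem_sup_left hx))
    obtain ⟨t, ht, h2⟩ := hB' (fun x hx => h x (Submodule.mem_sup_right hx))
    refine ⟨s * t, fun hts => (Ideal.IsPrime.mem_or_mem ‹_› hts).elim hs ht, fun x hx => ?_⟩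
    obtain ⟨y, hy, z, hz, rfl⟩ := Submodule.mem_sup.1 hx
    rw [smul_add, mul_comm, mul_smul, h1 y hy, mul_comm, mul_smul, h2 z hz]; simp

/-- finite depth -/
lemma mainA [IsNoetherianRing R] (a : Ideal R) (p : PrimeSpectrum R) (hap : a ≤ p.asIdeal)
    (M : Type) [AddCommGroup M] [Module R M] [Module.Finite R M]
    (hp : p ∈ Module.support R M) :
    ∃ i, ¬ Van p.asIdeal (ModuleCat.of R (R ⧸ a)) (ModuleCat.of R M) i := by
  by_contra! hcon
  -- maximal counterexample quotient
  let T : Set (Submodule R M) := {N | p ∈ Module.support R (M ⧸ N) ∧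
    ∀ i, Van p.asIdeal (ModuleCat.of R (R ⧸ a)) (ModuleCat.of R (M ⧸ N)) i}
  -- closure step
  have step : ∀ N ∈ T, ∀ Q : Submodule R (M ⧸ N), Q ≠ ⊥ → p ∈ Module.support R ((M ⧸ N) ⧸ Q) →
     (∀ i, Van p.asIdeal (ModuleCat.of R (R ⧸ a)) (ModuleCat.of R Q) i) → ∃ N' ∈ T, N < N' := by
    intro N hN Q hQ hpQ hv
    have hle : N ≤ Q.comap N.mkQ := by
      intro x hx
      have : N.mkQ x = 0 := by simpa using hx
      simp [Submodule.mem_comap, this, -Submodule.mkQ_apply]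
    have hQm : (Q.comap N.mkQ).map N.mkQ = Q :=
      Submodule.map_comap_eq_of_surjective (Submodule.mkQ_surjective N) Q
    let e : ((M ⧸ N) ⧸ Q) ≃ₗ[R] M ⧸ Q.comap N.mkQ :=
      (Submodule.quotEquivOfEq _ _ hQm.symm).trans (Submodule.quotientQuotientEquivQuotient N _ hle)
    refine ⟨Q.comap N.mkQ, ⟨?_, ?_⟩, lt_of_le_of_ne hle ?_⟩
    · rwa [← e.support_eq]
    · have := van_cov (shortExact_mk Q.subtype (e.toLinearMap ∘ₗ Q.mkQ) Q.injective_subtype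
        (e.surjective.comp Q.mkQ_surjective) (by
          intro x
          simp)) _ hv hN.2
      exact this
    · intro h
      apply hQ
      rw [← hQm, ← h]
      simp
  have hT : T.Nonempty := by
    refine ⟨⊥, ?_, ?_⟩
    · rwa [(Submodule.quotEquivOfEqBot (⊥ : Submodule R M) rfl).support_eq]
    · exact fun i => van_iso2
        (Submodule.quotEquivOfEqBot (⊥ : Submodule R M) rfl).symm.toModuleIso (hcon i)
  obtain ⟨N, hNT, hmax⟩ := WellFounded.has_min (wellFounded_gt (α := Submodule R M)) T hT
  have hmax' : ∀ N' ∈ T, ¬ N < N' := fun N' h h' => hmax N' h h'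
  have hone : (1 : R) ∉ p.asIdeal := (Ideal.ne_top_iff_one _).1 p.2.ne_top
  -- torsion is zero
  have htor : ptor p.asIdeal (M ⧸ N) = ⊥ := by
    by_contra hne
    obtain ⟨s, hs, hk⟩ := fg_kill p.asIdeal (ptor p.asIdeal (M ⧸ N)) (IsNoetherian.noetherian _)
      (fun x hx => hx)
    obtain ⟨N', h1, h2⟩ := step N hNT _ hne (by
      obtain ⟨m, hm⟩ := Module.mem_support_iff'.1 hNT.1
      refine Module.mem_support_iff'.2 ⟨Submodule.Quotient.mk m, fun r hr h0 => ?_⟩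
      rw [← Submodule.Quotient.mk_smul, Submodule.Quotient.mk_eq_zero] at h0
      obtain ⟨t, ht, h0⟩ := h0
      rw [smul_smul] at h0
      exact hm (t * r) (fun hts => (p.2.mem_or_mem hts).elim ht hr) h0)
      (fun i => van_kill _ _ s hs (fun (m : ptor p.asIdeal (M ⧸ N)) => Subtype.ext (hk m.1 m.2)) i)
    exact hmax' N' h1 h2
  -- hence no homs
  have hsub : Subsingleton ((R ⧸ a) →ₗ[R] (M ⧸ N)) := by
    refine ⟨fun f g => ?_⟩
    suffices ∀ f : (R ⧸ a) →ₗ[R] (M ⧸ N), f = 0 by rw [this f, this g]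
    intro f
    obtain ⟨s, hs, h⟩ := hNT.2 0 (Abelian.Ext.mk₀ (ModuleCat.ofHom f))
    rw [← Abelian.Ext.mk₀_smul] at h
    have h' : s • ModuleCat.ofHom f = 0 := by
      apply (Abelian.Ext.mk₀_bijective _ _).1
      simpa using h
    ext
    have h2 : s • f 1 = 0 := congrArg (fun t => t.hom (1 : R ⧸ a)) h'
    have : f 1 ∈ ptor p.asIdeal (M ⧸ N) := ⟨s, hs, h2⟩
    rw [htor] at this
    simpa using this
  obtain ⟨x, hx, hreg⟩ := IsSMulRegular.subsingleton_linearMap_iff.1 hsub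
  rw [Ideal.annihilator_quotient] at hx
  let l : (M ⧸ N) →ₗ[R] (M ⧸ N) := LinearMap.lsmul R (M ⧸ N) x
  have hl : Function.Injective l := hreg
  have hle : LinearMap.range l = x • (⊤ : Submodule R (M ⧸ N)) := by
    ext y
    simp [l, Submodule.mem_smul_pointwise_iff_exists]
  obtain ⟨N', h1, h2⟩ := step N hNT (LinearMap.range l) (by
      intro h0
      rw [LinearMap.range_eq_bot] at h0
      obtain ⟨m, hm⟩ := Module.mem_support_iff'.1 hNT.1
      apply hm 1 hone
      rw [one_smul]
      apply hl
      simp [h0])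
    (by
      rw [(Submodule.quotEquivOfEq _ _ hle).support_eq]
      have := (Module.support_quotSMulTop (R := R) (M := M ⧸ N) x)
      refine this.symm.subset ?_
      exact ⟨hNT.1, by simpa using hap hx⟩)
    (fun i => van_iso2 (LinearEquiv.ofInjective l hl).toModuleIso (hNT.2 i))
  exact hmax' N' h1 h2

/-- the transition map on quotients, as in the definition of local cohomology -/
def tr {I J : Ideal R} (h : I ≤ J) : ModuleCat.of R (R ⧸ I) ⟶ ModuleCat.of R (R ⧸ J) :=
  ModuleCat.ofHom (Submodule.mapQ I J LinearMap.id h)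

lemma van_devissage [IsNoetherianRing R] (a : Ideal R) (p : Ideal R) [p.IsPrime]
    (M : ModuleCat.{0} R) (j n : ℕ)
    (h : ∀ J : Ideal R, a ^ n ≤ J → Van p (ModuleCat.of R (R ⧸ J)) M j)
    (N : Type) [AddCommGroup N] [Module R N] [hN : Module.Finite R N]
    (ha : a ^ n ≤ Module.annihilator R N) : Van p (ModuleCat.of R N) M j := by
  revert ha
  refine IsNoetherianRing.induction_on_isQuotientEquivQuotientPrime R hN
    (motive := fun N _ _ _ => a ^ n ≤ Module.annihilator R N → Van p (ModuleCat.of R N) M j)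
    ?_ ?_ ?_
  · intro N _ _ _ _ _
    exact van_kill' _ _ 1 ((Ideal.ne_top_iff_one _).1 (Ideal.IsPrime.ne_top ‹_›))
      (fun (m : N) => Subsingleton.elim _ _) j
  · intro N _ _ _ q e ha
    rw [e.annihilator_eq, Ideal.annihilator_quotient] at ha
    exact van_iso e.symm.toModuleIso (h _ ha)
  · intro N₁ _ _ _ N₂ _ _ _ N₃ _ _ _ f g hf hg hfg h1 h3 ha
    exact van_mid (shortExact_mk f g hf hg hfg) M j
      (h1 (ha.trans (f.annihilator_le_of_injective hf)))
      (h3 (ha.trans (g.annihilator_le_of_surjective hg)))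

lemma mainB [IsNoetherianRing R] (a : Ideal R) (p : PrimeSpectrum R) (hap : a ≤ p.asIdeal)
    (M : ModuleCat.{0} R) [Module.Finite R M] (hp : p ∈ Module.support R M) :
    ∃ (i n : ℕ) (x : Abelian.Ext.{0} (ModuleCat.of R (R ⧸ a ^ n)) M i),
      ∀ (m : ℕ) (h : a ^ m ≤ a ^ n),
        ¬ Dies p.asIdeal ((Abelian.Ext.mk₀ (tr h)).comp x (zero_add i)) := by
  classical
  have hex : ∃ i, ∃ n, ∃ J : Ideal R, a ^ n ≤ J ∧
      ¬ Van p.asIdeal (ModuleCat.of R (R ⧸ J)) M i := by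
    obtain ⟨i, hi⟩ := mainA a p hap M hp
    exact ⟨i, 1, a, by simp, hi⟩
  have hlt := fun j hj => Nat.find_min (m := j) hex hj
  obtain ⟨n, J, hJ, hv⟩ := Nat.find_spec hex
  generalize Nat.find hex = i at hlt hv
  push Not at hlt
  have key : ∀ (m : ℕ) (I J : Ideal R) (hI : a ^ m ≤ I) (h : I ≤ J)
      (x : Abelian.Ext.{0} (ModuleCat.of R (R ⧸ J)) M i),
      Dies p.asIdeal ((Abelian.Ext.mk₀ (tr h)).comp x (zero_add i)) → Dies p.asIdeal x := by
    intro m I J hI h x hx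
    let g : (R ⧸ I) →ₗ[R] (R ⧸ J) := Submodule.mapQ I J LinearMap.id h
    have hg : Function.Surjective g := by
      intro y
      obtain ⟨r, rfl⟩ := Submodule.Quotient.mk_surjective _ y
      exact ⟨Submodule.Quotient.mk r, rfl⟩
    refine van_inj (shortExact_mk (LinearMap.ker g).subtype g (Submodule.injective_subtype _) hg
      (LinearMap.exact_subtype_ker_map g)) M i (fun j hj => ?_) x hx
    refine van_devissage a p.asIdeal M j m (fun J hJ => hlt j hj m J hJ) (LinearMap.ker g) ?_
    refine le_trans ?_ ((LinearMap.ker g).subtype.annihilator_le_of_injective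
      (Submodule.injective_subtype _))
    rwa [Ideal.annihilator_quotient]
  unfold Van at hv
  push Not at hv
  obtain ⟨x, hx⟩ := hv
  refine ⟨i, n, (Abelian.Ext.mk₀ (tr hJ)).comp x (zero_add i), fun m h hd => hx ?_⟩
  exact key n _ _ le_rfl hJ x (key m _ _ le_rfl h _ hd)


/-- if the old class is zero, so is the new one -/
lemma extMk_of_zq {X : ModuleCat.{0} R} (P : ProjectiveResolution X) (Y : ModuleCat.{0} R) (n : ℕ)
    (z : Z P Y n) (hz : zq P Y n z = 0) :
    P.extMk (zi P Y n z : P.complex.X n ⟶ Y) (n+1) rfl (zi_cocycle P Y n z) = 0 := by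
  cases n with
  | zero =>
    have := zq_eq_zero_zero P Y z hz
    subst this
    have h0 : (zi P Y 0 0 : P.complex.X 0 ⟶ Y) = 0 := (zi P Y 0).hom.map_zero
    simp [h0]
  | succ n =>
    exact (P.extMk_eq_zero_iff _ _ rfl _ n rfl).2 (zq_eq_zero_succ P Y n z hz)

lemma smul_extMk {X : ModuleCat.{0} R} (P : ProjectiveResolution X) (Y : ModuleCat.{0} R) (n : ℕ)
    (f : P.complex.X n ⟶ Y) (hf : P.complex.d (n+1) n ≫ f = 0) (s : R) :
    s • P.extMk f (n+1) rfl hf = P.extMk (s • f) (n+1) rfl (by simp [hf]) := by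
  rw [Abelian.Ext.smul_eq_comp_mk₀, P.extMk_comp_mk₀]
  congr 1
  all_goals simp

lemma exists_lift {X X' : ModuleCat.{0} R} (P : ProjectiveResolution X)
    (P' : ProjectiveResolution X') (g : X' ⟶ X) : Nonempty (ProjectiveResolution.Hom P' P g) :=
  ⟨⟨ProjectiveResolution.lift g P' P, by
    have := ProjectiveResolution.lift_commutes g P' P
    exact congrArg (fun t => HomologicalComplex.Hom.f t 0) this⟩⟩

lemma old_kill {X : ModuleCat.{0} R} (Y : ModuleCat.{0} R) (n : ℕ) (s : R)
    (hs : (∀ x : X, s • x = 0) ∨ (∀ y : Y, s • y = 0))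
    (x : ((Ext R (ModuleCat.{0} R) n).obj (op X)).obj Y) : s • x = 0 := by
  let P := projectiveResolution X
  obtain ⟨z, rfl⟩ := zq_surj P Y n x
  rcases hs with hs | hs
  · have h0 : s • 𝟙 X = 0 := by ext m; exact hs m
    let f0 : P.complex.X 0 ⟶ X := P.π.f 0
    have key : (s • 𝟙 (P.complex.X 0)) ≫ f0 = f0 ≫ (s • 𝟙 X) := by simp
    have key0 : (0 : P.complex.X 0 ⟶ P.complex.X 0) ≫ f0 = f0 ≫ (0 : X ⟶ X) := by simp
    let φ : ProjectiveResolution.Hom P P (0 : X ⟶ X) := ⟨s • 𝟙 _, by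
      rw [← h0]
      exact key⟩
    let ψ : ProjectiveResolution.Hom P P (0 : X ⟶ X) := ⟨0, by
      exact key0⟩
    obtain ⟨z1, h1, h1'⟩ := zq_nat P P Y n 0 φ z
    obtain ⟨z2, h2, h2'⟩ := zq_nat P P Y n 0 ψ z
    have e1 : z1 = s • z := by
      apply zi_inj P Y n
      rw [h1, (zi P Y n).hom.map_smul]
      simp [φ]
    have e2 : z2 = 0 := by
      apply zi_inj P Y n
      rw [h2, (zi P Y n).hom.map_zero]
      simp [ψ]
    rw [h1', e1, e2] at h2'
    rw [(zq P Y n).hom.map_smul, (zq P Y n).hom.map_zero] at h2'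
    exact h2'
  · have : s • z = 0 := by
      apply zi_inj P Y n
      rw [(zi P Y n).hom.map_smul, (zi P Y n).hom.map_zero]
      have h0 : s • 𝟙 Y = 0 := by ext m; exact hs m
      have h1 : s • (zi P Y n z : P.complex.X n ⟶ Y) = (zi P Y n z : P.complex.X n ⟶ Y) ≫ (s • 𝟙 Y) := by simp
      rw [h0, comp_zero] at h1
      exact h1
    rw [← (zq P Y n).hom.map_smul, this]
    exact (zq P Y n).hom.map_zero

/-- The evaluated diagram. -/
noncomputable abbrev dg (a : Ideal R) (i : ℕ) (M : ModuleCat.{0} R) : ℕᵒᵖᵒᵖ ⥤ ModuleCat.{0} R :=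
  localCohomology.diagram (localCohomology.idealPowersDiagram a) i ⋙ (evaluation _ _).obj M

lemma exists_colim (a : Ideal R) (i : ℕ) (M : ModuleCat.{0} R) :
    ∃ c : Cocone (dg a i M), c.pt = (localCohomology a i).obj M ∧ Nonempty (IsColimit c) := by
  have := localCohomology.hasColimitDiagram.{0, 0} (localCohomology.idealPowersDiagram a) i
  exact ⟨((evaluation _ _).obj M).mapCocone (colimit.cocone
    (localCohomology.diagram (localCohomology.idealPowersDiagram a) i)), rfl,
    ⟨isColimitOfPreserves _ (colimit.isColimit _)⟩⟩

lemma supp_le (a : Ideal R) (i : ℕ) (M : ModuleCat.{0} R) [Module.Finite R M] :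
    Module.support R ((localCohomology a i).obj M) ⊆
      Module.support R M ∩ PrimeSpectrum.zeroLocus (a : Set R) := by
  obtain ⟨c, hc, ⟨hcol⟩⟩ := exists_colim a i M
  rw [← hc]
  intro p hp
  obtain ⟨x, hx⟩ := Module.mem_support_iff'.1 hp
  obtain ⟨n, y, rfl⟩ := Concrete.isColimit_exists_rep _ hcol x
  have key : ∀ s : R, ((∀ x : R ⧸ a ^ (n.unop.unop), s • x = 0) ∨ (∀ y : M, s • y = 0)) → s ∈ p.asIdeal := by
    intro s hs
    by_contra hsp
    apply hx s hsp
    have h0 : s • y = 0 := old_kill (X := ModuleCat.of R (R ⧸ a ^ (n.unop.unop))) M i s hs y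
    have := (c.ι.app n).hom.map_smul s y
    refine this.symm.trans ?_
    rw [h0]
    exact (c.ι.app n).hom.map_zero
  constructor
  · rw [Module.support_eq_zeroLocus]
    intro s hs
    exact key s (Or.inr (fun y => Module.mem_annihilator.1 hs y))
  · have : a ^ (n.unop.unop) ≤ p.asIdeal := by
      intro s hs
      refine key s (Or.inl ?_)
      rw [← Module.mem_annihilator, Ideal.annihilator_quotient]
      exact hs
    exact p.2.le_of_pow_le this

lemma supp_ge [IsNoetherianRing R] (a : Ideal R) (M : ModuleCat.{0} R) [Module.Finite R M]
    (p : PrimeSpectrum R) (hap : a ≤ p.asIdeal) (hp : p ∈ Module.support R M) :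
    ∃ i, p ∈ Module.support R ((localCohomology a i).obj M) := by
  obtain ⟨i, n, x, hx⟩ := mainB a p hap M hp
  refine ⟨i, ?_⟩
  obtain ⟨c, hc, ⟨hcol⟩⟩ := exists_colim a i M
  rw [← hc]
  let P := fun m : ℕ => projectiveResolution (ModuleCat.of R (R ⧸ a ^ m))
  obtain ⟨f, hf, rfl⟩ := (P n).extMk_surjective x (n := i) (i+1) rfl
  obtain ⟨z, rfl⟩ := exists_zi (P n) M i f hf
  refine Module.mem_support_iff'.2 ⟨c.ι.app (op (op n)) (zq (P n) M i z), fun s hs h0 => ?_⟩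
  have h1 : c.ι.app (op (op n)) (zq (P n) M i (s • z)) = c.ι.app (op (op n)) (0 : (dg a i M).obj (op (op n))) := by
    refine Eq.trans ?_ (h0.trans ((c.ι.app (op (op n))).hom.map_zero).symm)
    have e := (zq (P n) M i).hom.map_smul s z
    refine (congrArg (c.ι.app (op (op n))) e).trans ?_
    exact (c.ι.app (op (op n))).hom.map_smul s _
  obtain ⟨k, u, v, h2⟩ := (Concrete.isColimit_rep_eq_iff_exists _ hcol _ _).1 h1
  have h2' := h2.trans ((((dg a i M).map v)).hom.map_zero)
  have hle : a ^ k.unop.unop ≤ a ^ n := Ideal.pow_le_pow_right u.unop.unop.down.down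
  obtain ⟨φ⟩ := exists_lift (P n) (P k.unop.unop) (tr hle)
  obtain ⟨z', hz', hz''⟩ := zq_nat (P n) (P k.unop.unop) M i (tr hle) φ (s • z)
  have h3 : zq (P k.unop.unop) M i z' = 0 := hz''.symm.trans h2'
  have h4 := extMk_of_zq _ _ _ _ h3
  apply hx k.unop.unop hle
  refine ⟨s, hs, ?_⟩
  rw [ProjectiveResolution.mk₀_comp_extMk _ _ _ _ φ, smul_extMk]
  refine Eq.trans ?_ h4
  congr 1
  rw [hz', (zi (P n) M i).hom.map_smul]
  simp

end RCM

theorem stmt11 {R : Type} [CommRing R] [IsNoetherianRing R]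
    (a : Ideal R) (M : ModuleCat R) [Module.Finite R M] (hM : Nontrivial M)
    (c : ℕ) (hcd : HasCD a M c)
    (hrcm : ∀ i, i ≠ c → Subsingleton ((localCohomology a i).obj M)) :
    Module.support R ((localCohomology a c).obj M) =
      Module.support R M ∩ PrimeSpectrum.zeroLocus (a : Set R) := by
  apply Set.Subset.antisymm (RCM.supp_le a c M)
  rintro p ⟨hp, hap⟩
  obtain ⟨i, hi⟩ := RCM.supp_ge a M p hap hp
  by_cases h : i = c
  · rwa [h] at hi
  · have := hrcm i h
    rw [Module.support_eq_empty] at hi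
    exact hi.elim
end

section
/- Let R be a Noetherian ring, 𝔞 an ideal, and M a nonzero finitely generated R-module with cd(𝔞, M) = 0. Then Ann_R(H^0_𝔞(M)) = Ann_R(M/T_R(𝔞, M)). -/
open CategoryTheory

namespace Stmt12
noncomputable section
open Opposite Limits
variable {R : Type} [CommRing R]

lemma sq_inv {D : Type*} [Category D] {A B A' B' : D} (i1 : A ≅ B) (i2 : A' ≅ B') (g : A ⟶ A')
    (h : B ⟶ B') (hyp : g ≫ i2.hom = i1.hom ≫ h) : i1.inv ≫ g = h ≫ i2.inv := by
  rw [Iso.inv_comp_eq, ← Category.assoc, Iso.eq_comp_inv, hyp]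

lemma sq_paste {D : Type*} [Category D] {a b c a' b' c' : D} (l : a ⟶ a') (p : a' ⟶ b')
    (q : a ⟶ b) (hm : b ⟶ b') (p2 : b' ⟶ c') (q2 : b ⟶ c) (m : c ⟶ c') (h1 : l ≫ p = q ≫ hm)
    (h2 : hm ≫ p2 = q2 ≫ m) : l ≫ (p ≫ p2) = (q ≫ q2) ≫ m := by
  rw [← Category.assoc, h1, Category.assoc, h2, Category.assoc]

lemma iso_inv_hom_app {A B : ModuleCat.{0} R} (i : A ≅ B) (b : B) : i.hom (i.inv b) = b := by
  simp

/-- The map on cochain complexes. -/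
def linYMap {X X' : ModuleCat.{0} R} (P : ProjectiveResolution X') (Q : ProjectiveResolution X)
    (φ : P.complex ⟶ Q.complex) (Y : ModuleCat.{0} R) :
    Q.complex.linearYonedaObj R Y ⟶ P.complex.linearYonedaObj R Y :=
  (HomologicalComplex.unopFunctor _ _).map
    ((((linearYoneda R (ModuleCat.{0} R)).obj Y).rightOp.mapHomologicalComplex _).map φ).op

lemma isoExt_nat {X X' : ModuleCat.{0} R} (f : X' ⟶ X)
    (P : ProjectiveResolution X') (Q : ProjectiveResolution X)
    (φ : ProjectiveResolution.Hom P Q f) (n : ℕ) (Y : ModuleCat.{0} R) :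
    ((Ext R (ModuleCat.{0} R) n).map f.op).app Y ≫ (P.isoExt n Y).hom =
      (Q.isoExt n Y).hom ≫ HomologicalComplex.homologyMap (linYMap P Q φ.hom Y) n := by
  have h1 := ProjectiveResolution.isoLeftDerivedObj_inv_naturality f P Q φ.hom
    (by simpa using φ.hom_f_zero_comp_π_f_zero) (((linearYoneda R (ModuleCat.{0} R)).obj Y).rightOp) n
  have h2 := HomologicalComplex.homologyOp_hom_naturality (linYMap P Q φ.hom Y) n
  have h4 : ((P.complex.linearYonedaObj R Y).homologyOp n).inv ≫
      HomologicalComplex.homologyMap ((HomologicalComplex.opFunctor _ _).map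
        (linYMap P Q φ.hom Y).op) n =
      (HomologicalComplex.homologyMap (linYMap P Q φ.hom Y) n).op ≫
        ((Q.complex.linearYonedaObj R Y).homologyOp n).inv := by
    exact sq_inv _ _ _ _ h2
  have h1' := congrArg Quiver.Hom.unop h1
  have h4' := congrArg Quiver.Hom.unop h4
  exact sq_paste _ _ _ _ _ _ _ h1' h4'

lemma linYMap_f {X X' : ModuleCat.{0} R} (P : ProjectiveResolution X') (Q : ProjectiveResolution X)
    (φ : P.complex ⟶ Q.complex) (Y : ModuleCat.{0} R) (n : ℕ) (ξ : Q.complex.X n ⟶ Y) :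
    ((linYMap P Q φ Y).f n).hom ξ = φ.f n ≫ ξ := rfl

/-- legacy ext -/
abbrev LExt (X Y : ModuleCat.{0} R) (n : ℕ) : ModuleCat R :=
  ((Ext R (ModuleCat.{0} R) n).obj (op X)).obj Y

/-- transition map -/
abbrev LMap {X X' : ModuleCat.{0} R} (f : X' ⟶ X) (Y : ModuleCat.{0} R) (n : ℕ) :
    LExt X Y n ⟶ LExt X' Y n := ((Ext R (ModuleCat.{0} R) n).map f.op).app Y

/-- representation by cocycle -/
def Rep {X Y : ModuleCat.{0} R} {n : ℕ} (P : ProjectiveResolution X) (x : LExt X Y n)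
    (ξ : P.complex.X n ⟶ Y) : Prop :=
  ∃ z : (P.complex.linearYonedaObj R Y).cycles n,
    (P.complex.linearYonedaObj R Y).iCycles n z = ξ ∧
    (P.isoExt n Y).hom x = (P.complex.linearYonedaObj R Y).homologyπ n z

lemma Rep.map {X X' Y : ModuleCat.{0} R} {n : ℕ} (f : X' ⟶ X) {P : ProjectiveResolution X'}
    {Q : ProjectiveResolution X}  (φ : ProjectiveResolution.Hom P Q f) {x : LExt X Y n}
    {ξ : Q.complex.X n ⟶ Y} (h : Rep Q x ξ) : Rep P (LMap f Y n x) (φ.hom.f n ≫ ξ) := by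
  obtain ⟨z, rfl, hz⟩ := h
  refine ⟨HomologicalComplex.cyclesMap (linYMap P Q φ.hom Y) n z, ?_, ?_⟩
  · have := ConcreteCategory.congr_hom
      (HomologicalComplex.cyclesMap_i (linYMap P Q φ.hom Y) n) z
    exact this
  · have h1 := ConcreteCategory.congr_hom (isoExt_nat f P Q φ n Y) x
    have h2 := ConcreteCategory.congr_hom
      (HomologicalComplex.homologyπ_naturality (linYMap P Q φ.hom Y) n) z
    simp only [ConcreteCategory.comp_apply] at h1 h2
    rw [hz] at h1
    exact h1.trans h2

lemma Rep.exists_cocycle {X Y : ModuleCat.{0} R} {n : ℕ} (P : ProjectiveResolution X)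
    (x : LExt X Y n) : ∃ ξ : P.complex.X n ⟶ Y, P.complex.d (n+1) n ≫ ξ = 0 ∧ Rep P x ξ := by
  obtain ⟨z, hz⟩ := (ModuleCat.epi_iff_surjective ((P.complex.linearYonedaObj R Y).homologyπ n)).1
    inferInstance ((P.isoExt n Y).hom x)
  refine ⟨_, ?_, z, rfl, hz.symm⟩
  exact ConcreteCategory.congr_hom ((P.complex.linearYonedaObj R Y).iCycles_d n (n+1)) z

lemma Rep.exists_class {X Y : ModuleCat.{0} R} {n : ℕ} (P : ProjectiveResolution X)
    (ξ : P.complex.X n ⟶ Y) (hξ : P.complex.d (n+1) n ≫ ξ = 0) :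
    ∃ x : LExt X Y n, Rep P x ξ := by
  refine ⟨(P.isoExt n Y).inv ((P.complex.linearYonedaObj R Y).homologyπ n
    ((P.complex.linearYonedaObj R Y).cyclesMk ξ (n+1) (by simp) hξ)),
    (P.complex.linearYonedaObj R Y).cyclesMk ξ (n+1) (by simp) hξ, ?_, ?_⟩
  · exact (P.complex.linearYonedaObj R Y).i_cyclesMk ξ (n+1) (by simp) hξ
  · exact iso_inv_hom_app (P.isoExt n Y) _

lemma Rep.eq_zero_iff {X Y : ModuleCat.{0} R} {n : ℕ} {P : ProjectiveResolution X}
    {x : LExt X Y (n+1)} {ξ : P.complex.X (n+1) ⟶ Y} (h : Rep P x ξ) :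
    x = 0 ↔ ∃ g : P.complex.X n ⟶ Y, P.complex.d (n+1) n ≫ g = ξ := by
  obtain ⟨z, rfl, hz⟩ := h
  set K := P.complex.linearYonedaObj R Y
  have e1 : x = 0 ↔ K.homologyπ (n+1) z = 0 := by
    rw [← hz]
    exact (map_eq_zero_iff _ ((ModuleCat.mono_iff_injective (P.isoExt (n+1) Y).hom).1
      inferInstance)).symm
  rw [e1]
  have ex : (ShortComplex.mk (K.toCycles n (n+1)) (K.homologyπ (n+1)) (by simp)).Exact :=
    ShortComplex.exact_of_g_is_cokernel _ (K.homologyIsCokernel n (n+1) (by simp))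
  rw [ShortComplex.moduleCat_exact_iff] at ex
  have inj := (ModuleCat.mono_iff_injective (K.iCycles (n+1))).1 inferInstance
  constructor
  · intro h0
    obtain ⟨g, hg⟩ := ex z h0
    refine ⟨g, ?_⟩
    rw [← hg]
    exact (ConcreteCategory.congr_hom (K.toCycles_i n (n+1)) g).symm
  · rintro ⟨g, hg⟩
    have : z = K.toCycles n (n+1) g := by
      apply inj
      rw [← hg]
      exact (ConcreteCategory.congr_hom (K.toCycles_i n (n+1)) g).symm
    rw [this]
    exact ConcreteCategory.congr_hom (K.toCycles_comp_homologyπ n (n+1)) g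

end
end Stmt12

namespace Stmt12
noncomputable section
open Opposite Limits
variable {R : Type} [CommRing R]

/-- `R / a^n`. -/
abbrev Qn (a : Ideal R) (n : ℕ) : ModuleCat.{0} R := ModuleCat.of R (R ⧸ a ^ n)

/-- the projection `R / a^m → R / a^n`. -/
def tr (a : Ideal R) {n m : ℕ} (h : n ≤ m) : Qn a m ⟶ Qn a n :=
  ModuleCat.ofHom <| Submodule.mapQ _ _ LinearMap.id (Ideal.pow_le_pow_right h)

/-- the diagram -/
abbrev dg (a : Ideal R) (i : ℕ) := localCohomology.diagram (localCohomology.idealPowersDiagram a) i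

/-- The canonical map to the colimit -/
def lcι (a : Ideal R) (i n : ℕ) (M : ModuleCat.{0} R) :
    LExt (Qn a n) M i ⟶ (localCohomology a i).obj M :=
  (colimit.ι (dg a i) (op (op n))).app M

def lcColim (a : Ideal R) (i : ℕ) (M : ModuleCat.{0} R) :=
  isColimitOfPreserves ((evaluation _ _).obj M) (colimit.isColimit (dg a i))

lemma lc_exists_rep (a : Ideal R) (i : ℕ) (M : ModuleCat.{0} R) (x : (localCohomology a i).obj M) :
    ∃ n y, lcι a i n M y = x := by
  obtain ⟨j, y, h⟩ := Concrete.isColimit_exists_rep _ (lcColim a i M) x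
  exact ⟨_, y, h⟩

lemma lc_zero_iff (a : Ideal R) (i n : ℕ) (M : ModuleCat.{0} R) (x : LExt (Qn a n) M i) :
    lcι a i n M x = 0 ↔ ∃ m, ∃ h : n ≤ m, LMap (tr a h) M i x = 0 := by
  have := Limits.IsColimit.eq_iff' (F := dg a i ⋙ (evaluation _ _).obj M) (lcColim a i M)
    (i := op (op n)) x 0
  refine (Iff.trans (by
    rw [map_zero]; rfl) this).trans ?_
  constructor
  · rintro ⟨j, f, h⟩
    rw [map_zero] at h
    exact ⟨j.unop.unop, f.unop.unop.down.down, h⟩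
  · rintro ⟨m, h, hx⟩
    refine ⟨op (op m), (homOfLE h).op.op, ?_⟩
    rw [map_zero]
    exact hx

open Abelian in
/-- vanishing in the colimit -/
def V (a : Ideal R) (i : ℕ) (M : ModuleCat.{0} R) : Prop :=
  ∀ n (ξ : Ext.{0} (Qn a n) M i), ∃ m, ∃ h : n ≤ m,
    (Ext.mk₀ (tr a h)).comp ξ (zero_add i) = 0

lemma V_iff (a : Ideal R) (i : ℕ) (M : ModuleCat.{0} R) :
    Subsingleton ((localCohomology a (i+1)).obj M) ↔ V a (i+1) M := by
  have key : ∀ (n m : ℕ) (h : n ≤ m) (P : ProjectiveResolution (Qn a n))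
      (x : LExt (Qn a n) M (i+1)) (ξ : P.complex.X (i+1) ⟶ M)
      (hξ : P.complex.d (i+1+1) (i+1) ≫ ξ = 0) (_ : Rep P x ξ),
      LMap (tr a h) M (i+1) x = 0 ↔
      (Abelian.Ext.mk₀ (tr a h)).comp (P.extMk ξ (i+1+1) rfl hξ) (zero_add (i+1)) = 0 := by
    intro n m h P x ξ hξ hx
    obtain ⟨P'⟩ : Nonempty (ProjectiveResolution (Qn a m)) := ⟨projectiveResolution _⟩
    let φ : ProjectiveResolution.Hom P' P (tr a h) :=
      ⟨ProjectiveResolution.lift (tr a h) P' P,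
        (ProjectiveResolution.lift_commutes_zero _ _ _).trans (by simp)⟩
    rw [ProjectiveResolution.mk₀_comp_extMk ξ _ rfl hξ φ, (hx.map _ φ).eq_zero_iff,
      ProjectiveResolution.extMk_eq_zero_iff _ _ _ _ _ i rfl]
  constructor
  · intro hs n ξ
    obtain ⟨P⟩ : Nonempty (ProjectiveResolution (Qn a n)) := ⟨projectiveResolution _⟩
    obtain ⟨f, hf, rfl⟩ := P.extMk_surjective ξ (i+1+1) rfl
    obtain ⟨x, hx⟩ := Rep.exists_class P f hf
    obtain ⟨m, h, h0⟩ := (lc_zero_iff a _ n M x).1 (Subsingleton.elim _ _)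
    exact ⟨m, h, (key n m h P x f hf hx).1 h0⟩
  · intro hV
    refine subsingleton_of_forall_eq 0 fun y => ?_
    obtain ⟨n, x, rfl⟩ := lc_exists_rep a _ M y
    rw [lc_zero_iff]
    obtain ⟨P⟩ : Nonempty (ProjectiveResolution (Qn a n)) := ⟨projectiveResolution _⟩
    obtain ⟨ξ, hξ, hr⟩ := Rep.exists_cocycle P x
    obtain ⟨m, h, h0⟩ := hV n (P.extMk ξ (i+1+1) rfl hξ)
    exact ⟨m, h, (key n m h P x ξ hξ hr).2 h0⟩

lemma H0 (a : Ideal R) (M : ModuleCat.{0} R) :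
    ∃ θ : ∀ n, (Qn a n ⟶ M) →ₗ[R] (localCohomology a 0).obj M,
      (∀ n g, θ n g = 0 → g = 0) ∧ ∀ x, ∃ n g, θ n g = x := by
  have : PreservesLimits (((linearYoneda R (ModuleCat.{0} R)).obj M) ⋙
      forget (ModuleCat.{0} R)) := inferInstanceAs (PreservesLimits (yoneda.obj M))
  have : PreservesLimits ((linearYoneda R (ModuleCat.{0} R)).obj M) :=
    preservesLimits_of_reflects_of_preserves _ (forget _)
  have : PreservesFiniteLimits ((linearYoneda R (ModuleCat.{0} R)).obj M) :=
    PreservesLimits.preservesFiniteLimits _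
  have : PreservesFiniteColimits ((linearYoneda R (ModuleCat.{0} R)).obj M).rightOp :=
    preservesFiniteColimits_rightOp _
  let F := ((linearYoneda R (ModuleCat.{0} R)).obj M).rightOp
  let e : ∀ X, ModuleCat.of R (X ⟶ M) ≅ LExt X M 0 := fun X => (F.leftDerivedZeroIsoSelf.app X).unop
  have he : ∀ {X X' : ModuleCat.{0} R} (f : X' ⟶ X) (g : X ⟶ M),
      LMap f M 0 ((e X).hom g) = (e X').hom (f ≫ g) := by
    intro X X' f g
    have := congrArg Quiver.Hom.unop (F.leftDerivedZeroIsoSelf.hom.naturality f)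
    exact (ConcreteCategory.congr_hom this g)
  refine ⟨fun n => ((e _).hom ≫ lcι a 0 n M).hom, ?_, ?_⟩
  · intro n g h0
    obtain ⟨m, h, h1⟩ := (lc_zero_iff a _ n M _).1 h0
    have h2 := (he (tr a h) g).symm.trans h1
    have h3 : tr a h ≫ g = 0 := by
      have := congrArg (e (Qn a m)).inv h2
      rw [map_zero] at this
      simpa using this
    have : Epi (tr a h) := by
      rw [ModuleCat.epi_iff_surjective]
      intro y
      obtain ⟨r, rfl⟩ := Ideal.Quotient.mk_surjective y
      exact ⟨Ideal.Quotient.mk _ r, rfl⟩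
    exact (cancel_epi (tr a h)).1 (by simpa using h3)
  · intro x
    obtain ⟨n, y, rfl⟩ := lc_exists_rep a _ M x
    refine ⟨n, (e _).inv y, ?_⟩
    exact congrArg (lcι a 0 n M) (iso_inv_hom_app (e (Qn a n)) y)

end
end Stmt12

namespace Stmt12
noncomputable section
open Opposite Limits
variable {R : Type} [CommRing R]

/-- `a`-torsion submodule -/
def tors (a : Ideal R) (N : Type) [AddCommGroup N] [Module R N] : Submodule R N where
  carrier := {x | ∃ n, ∀ r ∈ a ^ n, r • x = 0}
  zero_mem' := ⟨0, fun r _ => smul_zero r⟩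
  add_mem' := by
    rintro x y ⟨n, hn⟩ ⟨m, hm⟩
    refine ⟨n + m, fun r hr => ?_⟩
    rw [smul_add, hn r (Ideal.pow_le_pow_right (by omega) hr),
      hm r (Ideal.pow_le_pow_right (by omega) hr), add_zero]
  smul_mem' := by
    rintro c x ⟨n, hn⟩
    exact ⟨n, fun r hr => by rw [smul_comm, hn r hr, smul_zero]⟩

lemma mem_tors {a : Ideal R} {N : Type} [AddCommGroup N] [Module R N] {x : N} :
    x ∈ tors a N ↔ ∃ n, ∀ r ∈ a ^ n, r • x = 0 := Iff.rfl

lemma unif (a : Ideal R) {P N : Type} [AddCommGroup P] [Module R P] [AddCommGroup N] [Module R N]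
    [Module.Finite R P] (f : P →ₗ[R] N) (hf : ∀ p, f p ∈ tors a N) :
    ∃ k, ∀ r ∈ a ^ k, ∀ p, r • f p = 0 := by
  obtain ⟨s, hs⟩ := (Module.finite_def (R := R) (M := P)).1 inferInstance
  choose n hn using hf
  refine ⟨s.sup n, fun r hr p => ?_⟩
  have hp : p ∈ Submodule.span R (s : Set P) := by rw [hs]; trivial
  induction hp using Submodule.span_induction with
  | mem x hx => exact hn x r (Ideal.pow_le_pow_right (Finset.le_sup hx) hr)
  | zero => simp
  | add x y _ _ hx hy => rw [map_add, smul_add, hx, hy, add_zero]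
  | smul c x _ hx => rw [map_smul, smul_comm, hx, smul_zero]

lemma tors_injective [IsNoetherianRing R] (a : Ideal R) (E : Type) [AddCommGroup E] [Module R E]
    [hE : Module.Injective R E] : Module.Injective R (tors a E) := by
  apply Module.Baer.injective
  intro I f
  obtain ⟨k, hk⟩ := unif a ((tors a E).subtype ∘ₗ f) (fun p => (f p).2)
  obtain ⟨c, hc⟩ := Ideal.exists_pow_inf_eq_pow_smul a (I : Submodule R R)
  have hAR : ∀ x ∈ a ^ (k + c), x ∈ I → x ∈ a ^ k • (I : Submodule R R) := by
    intro x hx hxI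
    have h1 := hc (k + c) (by omega)
    have : x ∈ (a ^ (k + c) • ⊤ ⊓ I : Submodule R R) := ⟨by simpa using hx, hxI⟩
    rw [h1, Nat.add_sub_cancel] at this
    exact Submodule.smul_mono le_rfl inf_le_right this
  have hz : ∀ x (hx : x ∈ I), x ∈ a ^ (k + c) → ((f ⟨x, hx⟩ : tors a E) : E) = 0 := by
    intro x hx hxa
    have h2 := hAR x hxa hx
    have : ∀ y ∈ a ^ k • (I : Submodule R R), ∀ hy : y ∈ I, ((f ⟨y, hy⟩ : tors a E) : E) = 0 := by
      intro y hy
      induction hy using Submodule.smul_induction_on' with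
      | smul r hr n hn =>
        intro hy
        have : (⟨r • n, hy⟩ : I) = r • ⟨n, hn⟩ := rfl
        rw [this, map_smul]
        exact hk r hr ⟨n, hn⟩
      | add u hu v hv h1 h2 =>
        intro hy
        have hu' : u ∈ I := Submodule.smul_le_right hu
        have hv' : v ∈ I := Submodule.smul_le_right hv
        have : (⟨u + v, hy⟩ : I) = ⟨u, hu'⟩ + ⟨v, hv'⟩ := rfl
        rw [this, map_add, Submodule.coe_add, h1, h2, add_zero]
    exact this x h2 hx
  obtain ⟨h, hh⟩ := hE.out
    (Submodule.mapQ (Submodule.comap (Submodule.subtype I) (a ^ (k + c))) (a ^ (k + c))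
      (Submodule.subtype I) le_rfl)
    (by
      rw [← LinearMap.ker_eq_bot, Submodule.ker_mapQ]
      exact Submodule.mkQ_map_self _)
    (Submodule.liftQ _ ((tors a E).subtype ∘ₗ f) (by
      rintro ⟨x, hx⟩ hxa
      exact hz x hx hxa))
  refine ⟨LinearMap.codRestrict (tors a E) (h ∘ₗ Submodule.mkQ (a ^ (k + c))) ?_, ?_⟩
  · intro x
    refine ⟨k + c, fun r hr => ?_⟩
    have : (Submodule.mkQ (a ^ (k + c))) (r • x) = 0 := by
      exact (Submodule.Quotient.mk_eq_zero _).2 (Ideal.mul_mem_right x _ hr)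
    rw [← map_smul, LinearMap.comp_apply, this, map_zero]
  · intro x hx
    apply Subtype.ext
    exact hh (Submodule.Quotient.mk ⟨x, hx⟩)

open Abelian

lemma tr_comp (a : Ideal R) {n m l : ℕ} (h : n ≤ m) (h' : m ≤ l) :
    tr a h' ≫ tr a h = tr a (h.trans h') := by
  ext x
  rfl

lemma V_shift3 (a : Ideal R) {S : ShortComplex (ModuleCat.{0} R)} (hS : S.ShortExact) (i : ℕ)
    (h2 : V a i S.X₂) (h1 : V a (i + 1) S.X₁) : V a i S.X₃ := by
  intro n ξ
  obtain ⟨m, hm, h0⟩ := h1 n (ξ.comp hS.extClass rfl)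
  rw [← Ext.comp_assoc _ _ _ (zero_add i) rfl (by omega)] at h0
  obtain ⟨x, hx⟩ := Ext.covariant_sequence_exact₃ _ hS _ _ h0
  obtain ⟨l, hl, h00⟩ := h2 m x
  refine ⟨l, hm.trans hl, ?_⟩
  rw [← tr_comp a hm hl, ← Ext.mk₀_comp_mk₀, Ext.comp_assoc _ _ _ (zero_add 0) (zero_add i) (by omega),
    ← hx, ← Ext.comp_assoc _ _ _ (zero_add i) (add_zero i) (by omega), h00, Ext.zero_comp]

lemma V_shift1 (a : Ideal R) {S : ShortComplex (ModuleCat.{0} R)} (hS : S.ShortExact) (i : ℕ)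
    (h3 : V a i S.X₃) (h2 : V a (i + 1) S.X₂) : V a (i + 1) S.X₁ := by
  intro n ξ
  obtain ⟨m, hm, h0⟩ := h2 n (ξ.comp (Ext.mk₀ S.f) (add_zero _))
  rw [← Ext.comp_assoc _ _ _ (zero_add (i+1)) rfl (by omega)] at h0
  obtain ⟨x, hx⟩ := Ext.covariant_sequence_exact₁ _ hS _ h0 rfl
  obtain ⟨l, hl, h00⟩ := h3 m x
  refine ⟨l, hm.trans hl, ?_⟩
  rw [← tr_comp a hm hl, ← Ext.mk₀_comp_mk₀, Ext.comp_assoc _ _ _ (zero_add 0) (zero_add _) (by omega),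
    ← hx, ← Ext.comp_assoc _ _ _ (zero_add i) rfl (by omega), h00, Ext.zero_comp]

/-- the map `R/a^n → N` from a torsion element -/
def homOf (a : Ideal R) (n : ℕ) (N : ModuleCat.{0} R) (x : N) (hx : ∀ r ∈ a ^ n, r • x = 0) :
    Qn a n ⟶ N :=
  ModuleCat.ofHom (Submodule.liftQ (a ^ n) (LinearMap.toSpanSingleton R N x) (fun r hr => hx r hr))

lemma homOf_one (a : Ideal R) (n : ℕ) (N : ModuleCat.{0} R) (x : N)
    (hx : ∀ r ∈ a ^ n, r • x = 0) : (homOf a n N x hx).hom (Submodule.Quotient.mk 1) = x := by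
  change (1 : R) • x = x
  simp

lemma hom_ext_one (a : Ideal R) {n : ℕ} {N : ModuleCat.{0} R} {f g : Qn a n ⟶ N}
    (h : f.hom (Submodule.Quotient.mk 1) = g.hom (Submodule.Quotient.mk 1)) : f = g := by
  apply ModuleCat.hom_ext
  apply Submodule.linearMap_qext
  apply LinearMap.ext_ring
  exact h

lemma hom_tors (a : Ideal R) {n : ℕ} {N : ModuleCat.{0} R} (f : Qn a n ⟶ N) :
    ∀ r ∈ a ^ n, r • f.hom (Submodule.Quotient.mk 1) = 0 := by
  intro r hr
  rw [← map_smul, ← Submodule.Quotient.mk_smul, (Submodule.Quotient.mk_eq_zero _).2, map_zero]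
  simpa using hr

lemma V_tors [IsNoetherianRing R] (a : Ideal R) (i : ℕ) : ∀ (N : ModuleCat.{0} R)
    (_ : ∀ x : N, x ∈ tors a N), V a (i + 1) N := by
  have main : ∀ (N : ModuleCat.{0} R) (_ : ∀ x : N, x ∈ tors a N),
      ∃ S : ShortComplex (ModuleCat.{0} R), S.ShortExact ∧ S.X₁ = N ∧ Injective S.X₂ ∧
        (∀ x : S.X₂, x ∈ tors a S.X₂) := by
    intro N hN
    let E : ModuleCat.{0} R := Injective.under N
    let ι : N ⟶ E := Injective.ι N
    have hι : Function.Injective ι := (ModuleCat.mono_iff_injective ι).1 inferInstance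
    have : Injective (ModuleCat.of R E) := inferInstanceAs (Injective (Injective.under N))
    have : Module.Injective R E := Module.injective_module_of_injective_object R E
    have := tors_injective a E
    let f : N →ₗ[R] tors a E := LinearMap.codRestrict _ ι.hom (fun x => by
      obtain ⟨n, hn⟩ := hN x
      exact ⟨n, fun r hr => by rw [← map_smul, hn r hr, map_zero]⟩)
    refine ⟨ShortComplex.mk (ModuleCat.ofHom f) (ModuleCat.ofHom (LinearMap.range f).mkQ) ?_,
      ?_, rfl, Module.injective_object_of_injective_module R (tors a E), ?_⟩
    · ext x
      simp
    · apply ModuleCat.shortComplex_shortExact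
      · exact LinearMap.exact_map_mkQ_range f
      · intro x y h
        exact hι (congrArg Subtype.val h)
      · exact Submodule.mkQ_surjective _
    · rintro ⟨x, n, hn⟩
      exact ⟨n, fun r hr => Subtype.ext (hn r hr)⟩
  induction i with
  | zero =>
    intro N hN n ξ
    obtain ⟨S, hS, rfl, hinj, ht⟩ := main N hN
    have h0 : ξ.comp (Ext.mk₀ S.f) (add_zero _) = 0 := Ext.eq_zero_of_injective _
    obtain ⟨x, hx⟩ := Ext.covariant_sequence_exact₁ _ hS _ h0 rfl
    obtain ⟨g, rfl⟩ := Ext.homEquiv₀.symm.surjective x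
    have hsurj : Function.Surjective S.g := (ModuleCat.epi_iff_surjective S.g).1 hS.epi_g
    obtain ⟨y, hy⟩ := hsurj (g.hom (Submodule.Quotient.mk 1))
    obtain ⟨m, hm⟩ := ht y
    have hm' : ∀ r ∈ a ^ (n + m), r • y = 0 := fun r hr =>
      hm r (Ideal.pow_le_pow_right (by omega) hr)
    refine ⟨n + m, by omega, ?_⟩
    have e : tr a (show n ≤ n + m by omega) ≫ g = homOf a _ _ y hm' ≫ S.g := by
      apply hom_ext_one
      have := homOf_one a _ _ y hm'
      rw [ModuleCat.hom_comp, ModuleCat.hom_comp, LinearMap.comp_apply, LinearMap.comp_apply, this]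
      exact hy.symm
    rw [← hx, ← Ext.comp_assoc _ _ _ (zero_add 0) rfl (by omega)]
    change ((Ext.mk₀ _).comp (Ext.mk₀ g) _).comp _ _ = _
    rw [Ext.mk₀_comp_mk₀, e, ← Ext.mk₀_comp_mk₀,
      Ext.comp_assoc _ _ _ (zero_add 0) rfl (by omega), hS.comp_extClass, Ext.comp_zero]
  | succ i ih =>
    intro N hN
    obtain ⟨S, hS, rfl, hinj, ht⟩ := main N hN
    apply V_shift1 a hS
    · apply ih
      intro x
      have hsurj : Function.Surjective S.g := (ModuleCat.epi_iff_surjective S.g).1 hS.epi_g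
      obtain ⟨y, rfl⟩ := hsurj x
      obtain ⟨n, hn⟩ := ht y
      exact ⟨n, fun r hr => by rw [← map_smul, hn r hr, map_zero]⟩
    · intro n ξ
      refine ⟨n, le_rfl, ?_⟩
      rw [Ext.eq_zero_of_injective ξ, Ext.comp_zero]

lemma V_zero_iff (a : Ideal R) (N : ModuleCat.{0} R) : V a 0 N ↔ tors a N = ⊥ := by
  constructor
  · intro h
    rw [eq_bot_iff]
    rintro x ⟨n, hn⟩
    obtain ⟨m, hm, h0⟩ := h n (Ext.mk₀ (homOf a n N x hn))
    rw [Ext.mk₀_comp_mk₀, Ext.mk₀_eq_zero_iff] at h0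
    have := congrArg (fun f : Qn a m ⟶ N => f.hom (Submodule.Quotient.mk 1)) h0
    exact (homOf_one a n N x hn).symm.trans this
  · intro h n ξ
    obtain ⟨g, rfl⟩ := Ext.homEquiv₀.symm.surjective ξ
    have : g = 0 := by
      apply hom_ext_one
      have : g.hom (Submodule.Quotient.mk 1) ∈ tors a N := ⟨n, hom_tors a g⟩
      rw [h] at this
      exact this
    refine ⟨n, le_rfl, ?_⟩
    subst this
    change (Ext.mk₀ _).comp (Ext.mk₀ 0) _ = 0
    simp

lemma exists_reg [IsNoetherianRing R] (a : Ideal R) (N : Type) [AddCommGroup N] [Module R N]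
    [Module.Finite R N] (h : tors a N = ⊥) : ∃ x ∈ a, IsSMulRegular N x := by
  by_contra! hc
  have hsub : (a : Set R) ⊆ ⋃ p ∈ associatedPrimes R N, (id p : Ideal R) := by
    have := biUnion_associatedPrimes_eq_compl_regular R N
    simp only [id]
    rw [this]
    exact fun x hx => hc x hx
  obtain ⟨p, hp, hle⟩ := (a.subset_union_prime_finite (associatedPrimes.finite R N) (f := id) 0 0
    fun _ h _ _ ↦ h.1).1 hsub
  rw [AssociatedPrimes.mem_iff, isAssociatedPrime_iff] at hp
  obtain ⟨prime, x, rfl⟩ := hp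
  have hx : x ∈ tors a N := by
    refine ⟨1, fun r hr => ?_⟩
    rw [pow_one] at hr
    have := hle hr
    simpa [Submodule.mem_colon_singleton] using this
  rw [h, Submodule.mem_bot] at hx
  subst hx
  exact prime.ne_top (by ext; simp [Submodule.mem_colon_singleton])

lemma V_top [IsNoetherianRing R] (a : Ideal R) (N : Type) [AddCommGroup N] [Module R N]
    [Module.Finite R N] (K : Submodule R N) :
    (∀ i, V a i (ModuleCat.of R (N ⧸ K))) → K ⊔ a • ⊤ = ⊤ := by
  have : IsNoetherian R N := inferInstance
  induction K using WellFoundedGT.induction with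
  | ind K ih =>
  intro hV
  obtain ⟨x, hxa, hx⟩ := exists_reg a (N ⧸ K) ((V_zero_iff a _).1 (hV 0))
  let K' : Submodule R N := K ⊔ LinearMap.range (LinearMap.lsmul R N x)
  have hle : K ≤ K' := le_sup_left
  have hK' : K' ≤ K ⊔ a • ⊤ := by
    refine sup_le_sup_left ?_ _
    rintro _ ⟨y, rfl⟩
    exact Submodule.smul_mem_smul hxa trivial
  rcases hle.eq_or_lt with heq | hlt
  · have : K = ⊤ := by
      rw [eq_top_iff]
      intro y _
      have h1 : x • y ∈ K := by
        rw [heq]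
        exact Submodule.mem_sup_right ⟨y, rfl⟩
      have h2 : x • (Submodule.Quotient.mk y : N ⧸ K) = x • 0 := by
        rw [smul_zero, ← Submodule.Quotient.mk_smul, Submodule.Quotient.mk_eq_zero]
        exact h1
      exact (Submodule.Quotient.mk_eq_zero _).1 (hx h2)
    rw [this, top_sup_eq]
  · have hV' : ∀ i, V a i (ModuleCat.of R (N ⧸ K')) := by
      intro i
      let S : ShortComplex (ModuleCat.{0} R) := ShortComplex.mk
        (ModuleCat.ofHom (LinearMap.lsmul R (N ⧸ K) x)) (ModuleCat.ofHom (Submodule.factor hle)) (by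
          ext y
          refine (Submodule.Quotient.mk_eq_zero _).2 ?_
          exact Submodule.mem_sup_right ⟨y, rfl⟩)
      have hS : S.ShortExact := by
        apply ModuleCat.shortComplex_shortExact
        · intro y
          constructor
          · obtain ⟨y, rfl⟩ := Submodule.Quotient.mk_surjective _ y
            intro h
            have h : y ∈ K' := (Submodule.Quotient.mk_eq_zero _).1 h
            obtain ⟨u, hu, _, ⟨v, rfl⟩, rfl⟩ := Submodule.mem_sup.1 h
            refine ⟨Submodule.Quotient.mk v, ?_⟩
            rw [Submodule.Quotient.mk_add, (Submodule.Quotient.mk_eq_zero _).2 hu, zero_add]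
            rfl
          · rintro ⟨y, rfl⟩
            exact ConcreteCategory.congr_hom S.zero y
        · exact hx
        · exact Submodule.factor_surjective hle
      exact V_shift3 a hS i (hV i) (hV (i+1))
    exact eq_top_iff.2 ((ih K' hlt hV').ge.trans (sup_le hK' le_sup_right))

lemma V_of_idem (a : Ideal R) (i : ℕ) (N : ModuleCat.{0} R) (e : R) (he : e ∈ a)
    (h : ∀ x : N, e • x = x) : V a i N := by
  intro n ξ
  refine ⟨n, le_rfl, ?_⟩
  have hn : ∀ x : N, e ^ n • x = x := by
    intro x
    induction n with
    | zero => simp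
    | succ n ih => rw [pow_succ, mul_smul, h, ih (Ext.mk₀ 0 |>.comp ξ (zero_add _))]
  have h1 : ξ = e ^ n • ξ := by
    rw [Ext.smul_eq_comp_mk₀]
    have : e ^ n • 𝟙 N = 𝟙 N := by
      ext x
      exact hn x
    rw [this, Ext.comp_mk₀_id]
  have h2 : e ^ n • ξ = 0 := by
    have : e ^ n • 𝟙 (Qn a n) = 0 := by
      apply hom_ext_one
      change e ^ n • (Submodule.Quotient.mk 1 : R ⧸ a ^ n) = 0
      rw [← Submodule.Quotient.mk_smul, Submodule.Quotient.mk_eq_zero]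
      simpa using Ideal.pow_mem_pow he n
    rw [← Ext.mk₀_id_comp ξ, ← Ext.smul_comp, ← Ext.mk₀_smul, this, Ext.mk₀_zero, Ext.zero_comp]
  rw [h1, h2, Ext.comp_zero]

lemma H0_subsingleton_iff (a : Ideal R) (N : ModuleCat.{0} R) :
    Subsingleton ((localCohomology a 0).obj N) ↔ tors a N = ⊥ := by
  obtain ⟨θ, h1, h2⟩ := H0 a N
  constructor
  · intro h
    rw [eq_bot_iff]
    rintro x ⟨n, hn⟩
    have := h1 n (homOf a n N x hn) (Subsingleton.elim _ _)
    have h3 := homOf_one a n N x hn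
    rw [this] at h3
    exact h3.symm
  · intro h
    refine subsingleton_of_forall_eq 0 fun y => ?_
    obtain ⟨n, g, rfl⟩ := h2 y
    have : g = 0 := by
      apply hom_ext_one
      have : g.hom (Submodule.Quotient.mk 1) ∈ tors a N := ⟨n, hom_tors a g⟩
      rw [h] at this
      exact this
    rw [this, map_zero]

lemma H0_ann (a : Ideal R) (N : ModuleCat.{0} R) (r : R) :
    r ∈ Module.annihilator R ((localCohomology a 0).obj N) ↔ ∀ x ∈ tors a N, r • x = 0 := by
  obtain ⟨θ, h1, h2⟩ := H0 a N
  rw [Module.mem_annihilator]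
  constructor
  · rintro h x ⟨n, hn⟩
    have := h (θ n (homOf a n N x hn))
    rw [← map_smul] at this
    have := h1 _ _ this
    have h3 := homOf_one a n N x hn
    rw [← h3]
    exact congrArg (fun f : Qn a n ⟶ N => f.hom (Submodule.Quotient.mk 1)) this
  · intro h y
    obtain ⟨n, g, rfl⟩ := h2 y
    have : r • g = 0 := by
      apply hom_ext_one
      exact h _ ⟨n, hom_tors a g⟩
    rw [← map_smul, this, map_zero]

lemma exists_e [IsNoetherianRing R] (a : Ideal R) (M : ModuleCat.{0} R) [Module.Finite R M]
    (h : ∀ i, V a (i + 1) M) : ∃ e ∈ a, (∀ x ∈ tors a M, e • x = 0) ∧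
      ∀ m : M, (1 - e) • m ∈ tors a M := by
  let Γ := tors a M
  have hΓ : ∀ x : Γ, x ∈ tors a Γ := by
    rintro ⟨x, n, hn⟩
    exact ⟨n, fun r hr => Subtype.ext (hn r hr)⟩
  have : IsNoetherian R M := inferInstance
  obtain ⟨k, hk⟩ := unif a (LinearMap.id : Γ →ₗ[R] Γ) hΓ
  have hV : ∀ i, V a i (ModuleCat.of R (M ⧸ Γ)) := by
    intro i
    cases i with
    | zero =>
      rw [V_zero_iff, eq_bot_iff]
      intro y hy
      obtain ⟨y, rfl⟩ := Submodule.Quotient.mk_surjective _ y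
      obtain ⟨n, hn⟩ := hy
      refine (Submodule.Quotient.mk_eq_zero _).2 ?_
      have h1 : ∀ r ∈ a ^ n, r • y ∈ Γ := fun r hr => by
        have := hn r hr
        exact (Submodule.Quotient.mk_eq_zero _).1 this
      refine ⟨k + n, fun r hr => ?_⟩
      rw [pow_add] at hr
      induction hr using Submodule.mul_induction_on' with
      | mem_mul_mem s hs t ht =>
        rw [mul_smul]
        exact congrArg Subtype.val (hk s hs ⟨t • y, h1 t ht⟩)
      | add u _ v _ hu hv => rw [add_smul, hu, hv, add_zero]
    | succ i =>
      let S : ShortComplex (ModuleCat.{0} R) := ShortComplex.mk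
        (ModuleCat.ofHom Γ.subtype) (ModuleCat.ofHom Γ.mkQ) (by ext y; simp)
      have hS : S.ShortExact := by
        apply ModuleCat.shortComplex_shortExact
        · exact LinearMap.exact_subtype_mkQ Γ
        · exact Γ.subtype_injective
        · exact Γ.mkQ_surjective
      exact V_shift3 a hS (i+1) (h i) (V_tors a (i + 1) _ hΓ)
  have htop := V_top a M Γ hV
  have htop' : (⊤ : Submodule R (M ⧸ Γ)) ≤ a • ⊤ := by
    have := congrArg (Submodule.map Γ.mkQ) htop
    rw [Submodule.map_sup, Submodule.map_smul'', Submodule.map_top, Submodule.range_mkQ,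
      Submodule.mkQ_map_self, bot_sup_eq] at this
    exact this.ge
  have hpow : ∀ j, (⊤ : Submodule R (M ⧸ Γ)) ≤ a ^ j • ⊤ := by
    intro j
    induction j with
    | zero => simp
    | succ j ih =>
      rw [pow_succ, Submodule.mul_smul]
      exact ih.trans (Submodule.smul_mono le_rfl htop')
  obtain ⟨r, hr, hr0⟩ := Submodule.exists_sub_one_mem_and_smul_eq_zero_of_fg_of_le_smul
    (a ^ (k + 1)) (⊤ : Submodule R (M ⧸ Γ)) Module.Finite.fg_top (hpow _)
  have he : 1 - r ∈ a ^ (k + 1) := by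
    rw [← neg_sub]
    exact neg_mem hr
  refine ⟨1 - r, Ideal.pow_le_self (by omega) he, ?_, ?_⟩
  · intro x hx
    exact congrArg Subtype.val (hk _ (Ideal.pow_le_pow_right (by omega) he) ⟨x, hx⟩)
  · intro m
    rw [sub_sub_cancel]
    exact (Submodule.Quotient.mk_eq_zero _).1 (hr0 (Submodule.Quotient.mk m) trivial)

end
end Stmt12

theorem stmt12 {R : Type} [CommRing R] [IsNoetherianRing R]
    (a : Ideal R) (M : ModuleCat R) [Module.Finite R M] (hM : Nontrivial M)
    (hcd : HasCD a M 0)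
    (T : Submodule R M)
    (hT : IsGreatest {N : Submodule R M |
      ∀ i : ℕ, Subsingleton ((localCohomology a i).obj (ModuleCat.of R N))} T) :
    Module.annihilator R ((localCohomology a 0).obj M) =
      Module.annihilator R (M ⧸ T) := by
  obtain ⟨e, hea, he0, he1⟩ := Stmt12.exists_e a M
    (fun i => (Stmt12.V_iff a i M).1 (hcd.2 (i + 1) (Nat.succ_pos i)))
  have hT0 : Stmt12.tors a T = ⊥ :=
    (Stmt12.H0_subsingleton_iff a (ModuleCat.of R T)).1 (hT.1 0)
  have hid : ∀ m : M, e • e • m = e • m := by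
    intro m
    have := he0 _ (he1 m)
    rw [sub_smul, one_smul, smul_sub, sub_eq_zero] at this
    exact this.symm
  let T' : Submodule R M := LinearMap.range (LinearMap.lsmul R M e)
  have hid' : ∀ x : T', e • x = x := by
    rintro ⟨_, m, rfl⟩
    exact Subtype.ext (hid m)
  have hT' : T' ≤ T := by
    apply hT.2
    intro i
    cases i with
    | zero =>
      exact (Stmt12.H0_subsingleton_iff a (ModuleCat.of R T')).2
        ((Stmt12.V_zero_iff a (ModuleCat.of R T')).1
          (Stmt12.V_of_idem a 0 (ModuleCat.of R T') e hea hid'))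
    | succ i =>
      exact (Stmt12.V_iff a i (ModuleCat.of R T')).2
        (Stmt12.V_of_idem a (i + 1) (ModuleCat.of R T') e hea hid')
  ext r
  rw [Stmt12.H0_ann, Module.mem_annihilator]
  constructor
  · intro h y
    obtain ⟨m, rfl⟩ := Submodule.Quotient.mk_surjective _ y
    rw [← Submodule.Quotient.mk_smul, Submodule.Quotient.mk_eq_zero]
    have h1 := h _ (he1 m)
    rw [sub_smul, one_smul, smul_sub, sub_eq_zero] at h1
    rw [h1]
    exact T.smul_mem r (hT' ⟨m, rfl⟩)
  · intro h x hx
    have h1 : r • x ∈ T := by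
      have := h (Submodule.Quotient.mk x)
      rwa [← Submodule.Quotient.mk_smul, Submodule.Quotient.mk_eq_zero] at this
    have h2 : (⟨r • x, h1⟩ : T) ∈ Stmt12.tors a T := by
      obtain ⟨n, hn⟩ := (Stmt12.tors a M).smul_mem r hx
      exact ⟨n, fun s hs => Subtype.ext (hn s hs)⟩
    rw [hT0] at h2
    exact congrArg Subtype.val h2
end
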